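/- arXiv:1311.0365 — 8 statements merged into one kernel-verified Lean document; each statement's English description precedes it below -/
import Mathlib

section
/- For every positive integer n, all zeros of the polynomial F_n(x) = Σ_{k=0}^n binom(n,k) (−x)^k / ((k+ν_1)! ⋯ (k+ν_r)!) are real and strictly positive. -/
open Real

open Polynomial

/-- If all roots of a complex polynomial are real, then so are those of `f' - r f` for real `r`. -/
theorem im_eq_zero_of_mem_roots_derivative_sub {f : ℂ[X]} (hf : ∀ z ∈ f.roots, z.im = 0)
    {r : ℂ} (hr : r.im = 0) : ∀ z ∈ (derivative f - C r * f).roots, z.im = 0 := by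
  intro z hz
  by_contra him
  have hz0 : (derivative f).eval z = r * f.eval z := by
    have h := isRoot_of_mem_roots hz
    simpa [IsRoot, sub_eq_zero] using h
  have hf0 : f ≠ 0 := by
    rintro rfl
    simp at hz
  have hfz : f.eval z ≠ 0 := fun h => him (hf z ((mem_roots hf0).2 h))
  have hlog := (IsAlgClosed.splits f).eval_derivative_div_eval_of_ne_zero hfz
  rw [hz0, mul_div_cancel_right₀ _ hfz] at hlog
  have key : ∀ s : Multiset ℂ, (∀ w ∈ s, w.im = 0) →
      (s.map fun w => 1 / (z - w)).sum.im =
        -z.im * (s.map fun w => (Complex.normSq (z - w))⁻¹).sum := by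
    intro s
    induction s using Multiset.induction_on with
    | empty => simp
    | cons w s ih =>
      intro hs
      have hw := hs w (Multiset.mem_cons_self w s)
      have ih' := ih fun u hu => hs u (Multiset.mem_cons_of_mem hu)
      rw [Multiset.map_cons, Multiset.sum_cons, Complex.add_im, ih', Multiset.map_cons,
        Multiset.sum_cons, one_div, Complex.inv_im, Complex.sub_im, hw]
      ring
  have hsum := key f.roots hf
  rw [← hlog, hr] at hsum
  have hsum0 : (f.roots.map fun w => (Complex.normSq (z - w))⁻¹).sum = 0 := by
    simpa [him] using hsum.symm
  rcases Multiset.empty_or_exists_mem f.roots with h | ⟨w, hw⟩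
  · rw [h] at hlog
    have hr0 : r = 0 := by simpa using hlog
    have hd : f.natDegree = 0 := by
      rw [(IsAlgClosed.splits f).natDegree_eq_card_roots, h, Multiset.card_zero]
    rw [hr0, derivative_of_natDegree_zero hd] at hz
    simp at hz
  · have hle := Multiset.single_le_sum (s := f.roots.map fun w => (Complex.normSq (z - w))⁻¹)
      (by
        intro x hx
        obtain ⟨u, -, rfl⟩ := Multiset.mem_map.1 hx
        exact inv_nonneg.2 (Complex.normSq_nonneg _)) _ (Multiset.mem_map_of_mem _ hw)
    rw [hsum0] at hle
    have hzw : z - w ≠ 0 := by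
      intro h
      rw [sub_eq_zero.1 h] at him
      exact him (hf w hw)
    exact absurd hle (not_le.2 (inv_pos.2 (Complex.normSq_pos.2 hzw)))

/-- If all roots of `q` and `f` are real, then so are those of `q(D) f`, with `D` the derivative. -/
theorem im_eq_zero_of_mem_roots_aeval_derivative {q f : ℂ[X]} (hq : ∀ z ∈ q.roots, z.im = 0)
    (hf : ∀ z ∈ f.roots, z.im = 0) :
    ∀ z ∈ (aeval (derivative : ℂ[X] →ₗ[ℂ] ℂ[X]) q f).roots, z.im = 0 := by
  have key : ∀ s : Multiset ℂ, (∀ w ∈ s, w.im = 0) →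
      ∀ z ∈ (aeval (derivative : ℂ[X] →ₗ[ℂ] ℂ[X]) (s.map fun w => X - C w).prod f).roots,
        z.im = 0 := by
    intro s
    induction s using Multiset.induction_on with
    | empty => simpa using hf
    | cons w s ih =>
      intro hs
      have h := im_eq_zero_of_mem_roots_derivative_sub
        (ih fun u hu => hs u (Multiset.mem_cons_of_mem hu)) (hs w (Multiset.mem_cons_self w s))
      simpa [Module.algebraMap_end_apply, smul_eq_C_mul] using h
  intro z hz
  by_cases hq0 : q = 0
  · simp [hq0] at hz
  rw [(IsAlgClosed.splits q).eq_prod_roots, map_mul, aeval_C, Module.End.mul_apply,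
    Module.algebraMap_end_apply, roots_smul_nonzero _ (leadingCoeff_ne_zero.2 hq0)] at hz
  exact key _ hq z hz

/-- The sequence `1 / (k + m)!` is a multiplier sequence. -/
theorem im_eq_zero_of_sum_div_factorial_eq_zero (n m : ℕ) {a : ℕ → ℂ} (ha : a 0 ≠ 0)
    (h : ∀ z : ℂ, ∑ k ∈ Finset.range (n + 1), a k * z ^ k = 0 → z.im = 0) (z : ℂ)
    (hz : ∑ k ∈ Finset.range (n + 1), a k / ((k + m).factorial : ℂ) * z ^ k = 0) :
    z.im = 0 := by
  set q : ℂ[X] := ∑ k ∈ Finset.range (n + 1), C (a k) * X ^ (n - k) with hqdef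
  set p : ℂ[X] := ∑ k ∈ Finset.range (n + 1), C (a k / ((k + m).factorial : ℂ)) * X ^ k with hpdef
  have hq : ∀ w ∈ q.roots, w.im = 0 := by
    intro w hw
    by_cases hw0 : w = 0
    · simp [hw0]
    have hroot : q.eval w = 0 := isRoot_of_mem_roots hw
    have hinv : (w⁻¹).im = 0 := by
      apply h
      have hmul : w ^ n * ∑ k ∈ Finset.range (n + 1), a k * w⁻¹ ^ k = 0 := by
        rw [← hroot, hqdef, eval_finsetSum, Finset.mul_sum]
        refine Finset.sum_congr rfl fun k hk => ?_
        have hkn : k ≤ n := Nat.lt_succ_iff.1 (Finset.mem_range.1 hk)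
        rw [eval_mul, eval_C, eval_pow, eval_X, pow_sub₀ w hw0 hkn, inv_pow]
        ring
      exact (mul_eq_zero.1 hmul).resolve_left (pow_ne_zero n hw0)
    simpa [Complex.inv_im, hw0] using hinv
  have hX : ∀ w ∈ ((X : ℂ[X]) ^ (n + m)).roots, w.im = 0 := by
    intro w hw
    have hw' : w ^ (n + m) = 0 := by simpa [IsRoot] using isRoot_of_mem_roots hw
    simp [eq_zero_of_pow_eq_zero hw']
  have heq : aeval (derivative : ℂ[X] →ₗ[ℂ] ℂ[X]) q (X ^ (n + m)) =
      C ((n + m).factorial : ℂ) * (X ^ m * p) := by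
    rw [hqdef, hpdef, map_sum, LinearMap.sum_apply, Finset.mul_sum, Finset.mul_sum]
    refine Finset.sum_congr rfl fun k hk => ?_
    have hkn : k ≤ n := Nat.lt_succ_iff.1 (Finset.mem_range.1 hk)
    have hsub : n + m - (n - k) = k + m := by omega
    have hfac := Nat.factorial_mul_descFactorial (show n - k ≤ n + m by omega)
    rw [hsub] at hfac
    rw [map_mul, aeval_C, aeval_X_pow, Module.End.mul_apply, Module.algebraMap_end_apply,
      Module.End.pow_apply, iterate_derivative_X_pow_eq_smul, hsub, ← hfac, smul_eq_C_mul,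
      smul_eq_C_mul]
    have hne : ((k + m).factorial : ℂ) ≠ 0 := Nat.cast_ne_zero.2 (Nat.factorial_ne_zero _)
    have hcoeff : a k * ((n + m).descFactorial (n - k) : ℂ) =
        (((k + m).factorial * (n + m).descFactorial (n - k) : ℕ) : ℂ) *
          (a k / ((k + m).factorial : ℂ)) := by
      push_cast
      field_simp
    calc C (a k) * (C ((n + m).descFactorial (n - k) : ℂ) * X ^ (k + m))
        = C (a k * ((n + m).descFactorial (n - k) : ℂ)) * X ^ (k + m) := by rw [C_mul]; ring
      _ = _ := by rw [hcoeff, C_mul]; ring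
  have hp0 : p ≠ 0 := by
    intro hp
    have h0 : p.eval 0 = a 0 / (m.factorial : ℂ) := by
      rw [hpdef, eval_finsetSum, Finset.sum_range_succ']
      simp
    rw [hp, eval_zero] at h0
    exact div_ne_zero ha (Nat.cast_ne_zero.2 (Nat.factorial_ne_zero m)) h0.symm
  have hpz : p.eval z = 0 := by
    rw [hpdef, eval_finsetSum, ← hz]
    simp
  apply im_eq_zero_of_mem_roots_aeval_derivative hq hX z
  rw [heq, mem_roots (mul_ne_zero (C_ne_zero.2 (Nat.cast_ne_zero.2 (Nat.factorial_ne_zero _)))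
    (mul_ne_zero (pow_ne_zero m X_ne_zero) hp0))]
  simp [IsRoot, hpz]

/-- The polynomial `∑ binom(n,k) z^k / ∏ (k + ν j)!` has only real zeros. -/
theorem im_eq_zero_of_sum_choose_div_prod_factorial_eq_zero {ι : Type*} (s : Finset ι)
    (ν : ι → ℕ) (n : ℕ) (z : ℂ)
    (hz : ∑ k ∈ Finset.range (n + 1),
      (n.choose k : ℂ) / (∏ j ∈ s, ((k + ν j).factorial : ℂ)) * z ^ k = 0) : z.im = 0 := by
  classical
  induction s using Finset.induction_on generalizing z with
  | empty =>
    have hpow : (z + 1) ^ n = 0 := by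
      rw [add_pow, ← hz]
      refine Finset.sum_congr rfl fun k _ => ?_
      simp [mul_comm]
    simp [eq_neg_of_add_eq_zero_left (eq_zero_of_pow_eq_zero hpow)]
  | insert i s hi ih =>
    refine im_eq_zero_of_sum_div_factorial_eq_zero n (ν i)
      (a := fun k => (n.choose k : ℂ) / ∏ j ∈ s, ((k + ν j).factorial : ℂ)) ?_ ih z ?_
    · simp [Finset.prod_ne_zero_iff, Nat.factorial_ne_zero]
    · rw [← hz]
      refine Finset.sum_congr rfl fun k _ => ?_
      rw [Finset.prod_insert hi, div_div, mul_comm (∏ j ∈ s, _)]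

/-- All zeros of the polynomial
`F_n(x) = Σ_{k=0}^n binom(n,k) (−x)^k / ((k+ν_1)! ⋯ (k+ν_r)!)`
are real and strictly positive. -/
theorem stmt_0 (r : ℕ) (hr : 1 ≤ r) (ν : Fin r → ℕ) (n : ℕ) (hn : 1 ≤ n)
    (z : ℂ)
    (hz : ∑ k ∈ Finset.range (n + 1),
        (n.choose k : ℂ) * (-z) ^ k / ∏ j, ((k + ν j).factorial : ℂ) = 0) :
    0 < z.re ∧ z.im = 0 := by
  have him : z.im = 0 := by
    have h := im_eq_zero_of_sum_choose_div_prod_factorial_eq_zero Finset.univ ν n (-z) (by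
      rw [← hz]
      exact Finset.sum_congr rfl fun k _ => div_mul_eq_mul_div _ _ _)
    simpa using h
  refine ⟨?_, him⟩
  by_contra! hre
  obtain ⟨x, rfl⟩ : ∃ x : ℝ, (x : ℂ) = z := ⟨z.re, Complex.ext rfl (by simp [him])⟩
  have hx : 0 ≤ -x := by simpa using hre
  have hsum : ∑ k ∈ Finset.range (n + 1),
      (n.choose k : ℝ) * (-x) ^ k / ∏ j, ((k + ν j).factorial : ℝ) = 0 := by
    exact_mod_cast hz
  have hzero := (Finset.sum_eq_zero_iff_of_nonneg fun k _ => by positivity).1 hsum 0 (by simp)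
  simp [Finset.prod_eq_zero_iff, Nat.factorial_ne_zero] at hzero
end

section
/- The function h attains its global maximum on [−π,π]^r exactly at the two points (φ,…,φ) and (−φ,…,−φ); that is, h(x) ≤ h(φ,…,φ) = h(−φ,…,−φ) for all x ∈ [−π,π]^r, with equality if and only if x = (φ,…,φ) or x = (−φ,…,−φ). -/
open Real

/-- The weighted triangle inequality for cosines, as an identity: for a triangle with angles
`α`, `β` and `π - (α + β)` the defect is a sum of two squares. -/
lemma triangle_defect {α β : ℝ} (hα : sin α ≠ 0) (hσ : sin (α + β) ≠ 0) (s y : ℝ) :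
    (cos β - sin β * cos (α + β) / sin (α + β) + sin β / sin (α + β) * cos (s + y)
      + sin β * cos α / sin α - sin β / sin α * cos s - cos y) * (2 * sin α * sin (α + β)) =
    (sin α + sin β * cos (s + y) - sin (α + β) * cos y) ^ 2
      + (sin β * sin (s + y) - sin (α + β) * sin y) ^ 2 := by
  have hs : cos s = cos (s + y) * cos y + sin (s + y) * sin y := by
    rw [← cos_sub, add_sub_cancel_right]
  have hsin : sin α = sin (α + β) * cos β - cos (α + β) * sin β := by
    rw [← sin_sub, add_sub_cancel_right]
  have hcos : cos α = cos (α + β) * cos β + sin (α + β) * sin β := by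
    rw [← cos_sub, add_sub_cancel_right]
  have hS := sin_sq_add_cos_sq (s + y)
  have hy := sin_sq_add_cos_sq y
  have hσ2 := sin_sq_add_cos_sq (α + β)
  have hβ := sin_sq_add_cos_sq β
  have hclear : (cos β - sin β * cos (α + β) / sin (α + β) + sin β / sin (α + β) * cos (s + y)
      + sin β * cos α / sin α - sin β / sin α * cos s - cos y) * (2 * sin α * sin (α + β)) =
      2 * (cos β * sin α * sin (α + β) - sin β * cos (α + β) * sin α
        + sin β * cos (s + y) * sin α + sin β * cos α * sin (α + β)
        - sin β * cos s * sin (α + β) - cos y * sin α * sin (α + β)) := by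
    field_simp
  rw [hclear, hs, hcos]
  generalize sin (s + y) = S at *
  generalize cos (s + y) = C at *
  generalize sin (α + β) = P at *
  generalize cos (α + β) = Q at *
  rw [hsin]
  linear_combination (-sin β ^ 2) * hS - P ^ 2 * hy + sin β ^ 2 * hσ2 + P ^ 2 * hβ

lemma triangle_defect_nonneg {α β : ℝ} (hα : 0 < sin α) (hσ : 0 < sin (α + β)) (s y : ℝ) :
    0 ≤ cos β - sin β * cos (α + β) / sin (α + β) + sin β / sin (α + β) * cos (s + y)
      + sin β * cos α / sin α - sin β / sin α * cos s - cos y := by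
  have hpos : 0 < 2 * sin α * sin (α + β) := by positivity
  refine (mul_nonneg_iff_of_pos_right hpos).1 ?_
  rw [triangle_defect hα.ne' hσ.ne']
  positivity

lemma sin_nat_succ_mul_pos {n : ℕ} {φ : ℝ} (h0 : 0 < φ) (h : ((n : ℝ) + 1) * φ < π) :
    0 < sin (((n : ℝ) + 1) * φ) :=
  sin_pos_of_pos_of_lt_pi (by positivity) h

lemma sum_cos_le {φ : ℝ} (h0 : 0 < φ) (n : ℕ) (h : ((n : ℝ) + 1) * φ < π)
    (x : Fin (n + 1) → ℝ) :
    ∑ j, cos (x j) ≤ ((n : ℝ) + 1) * cos φ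
      - sin φ * cos (((n : ℝ) + 1) * φ) / sin (((n : ℝ) + 1) * φ)
      + sin φ / sin (((n : ℝ) + 1) * φ) * cos (∑ j, x j) := by
  induction n with
  | zero =>
    have hs : sin φ ≠ 0 := by simpa using (sin_nat_succ_mul_pos h0 h).ne'
    simp [hs]
  | succ n ih =>
    push_cast at h ⊢
    have hn : ((n : ℝ) + 1) * φ < π := by nlinarith
    have hα := sin_nat_succ_mul_pos h0 hn
    have hσ : 0 < sin (((n : ℝ) + 1) * φ + φ) :=
      sin_pos_of_pos_of_lt_pi (by positivity) (by linarith)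
    have hx := ih hn fun j => x j.castSucc
    have hD0 := triangle_defect_nonneg hα hσ (∑ j : Fin (n + 1), x j.castSucc) (x (Fin.last _))
    rw [Fin.sum_univ_castSucc, Fin.sum_univ_castSucc (f := x), add_one_mul ((n : ℝ) + 1) φ]
    linarith

/-- If equality holds in `sum_cos_le` and the sum of the angles is `ε (n + 1) φ` modulo `2 * π`,
then each angle is `ε φ` modulo `2 * π`. -/
lemma cos_sin_eq_of_sum_cos_eq {φ ε : ℝ} (h0 : 0 < φ) (hε : ε ^ 2 = 1) (n : ℕ)
    (h : ((n : ℝ) + 1) * φ < π) (x : Fin (n + 1) → ℝ)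
    (heq : ∑ j, cos (x j) = ((n : ℝ) + 1) * cos φ)
    (hc : cos (∑ j, x j) = cos (((n : ℝ) + 1) * φ))
    (hs : sin (∑ j, x j) = ε * sin (((n : ℝ) + 1) * φ)) (j : Fin (n + 1)) :
    cos (x j) = cos φ ∧ sin (x j) = ε * sin φ := by
  induction n with
  | zero =>
    have hj : j = 0 := Fin.fin_one_eq_zero j
    subst hj
    simpa using And.intro hc hs
  | succ n ih =>
    push_cast at h heq hc hs
    have hn : ((n : ℝ) + 1) * φ < π := by nlinarith
    have hα := sin_nat_succ_mul_pos h0 hn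
    have hσ : 0 < sin (((n : ℝ) + 1) * φ + φ) :=
      sin_pos_of_pos_of_lt_pi (by positivity) (by linarith)
    have hx := sum_cos_le h0 n hn fun j => x j.castSucc
    have hD := triangle_defect hα.ne' hσ.ne' (∑ j : Fin (n + 1), x j.castSucc) (x (Fin.last _))
    have hD0 := triangle_defect_nonneg hα hσ (∑ j : Fin (n + 1), x j.castSucc) (x (Fin.last _))
    rw [Fin.sum_univ_castSucc] at heq hc hs
    rw [add_one_mul ((n : ℝ) + 1) φ] at hc hs
    set α := ((n : ℝ) + 1) * φ with hαdef
    set s := ∑ j : Fin (n + 1), x j.castSucc with hsdef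
    set y := x (Fin.last (n + 1)) with hydef
    have hcancel : sin φ / sin (α + φ) * cos (α + φ) = sin φ * cos (α + φ) / sin (α + φ) := by
      ring
    rw [hc, hcancel] at hD hD0
    have hzero : (cos φ - sin φ * cos (α + φ) / sin (α + φ)
        + sin φ * cos (α + φ) / sin (α + φ)
        + sin φ * cos α / sin α - sin φ / sin α * cos s - cos y) = 0 := by linarith
    rw [hzero, zero_mul] at hD
    have h1 : sin α + sin φ * cos (α + φ) - sin (α + φ) * cos y = 0 := by nlinarith
    have h2 : sin φ * sin (s + y) - sin (α + φ) * sin y = 0 := by nlinarith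
    have hsin : sin α = sin (α + φ) * cos φ - cos (α + φ) * sin φ := by
      rw [← sin_sub, add_sub_cancel_right]
    have hcos : cos α = cos (α + φ) * cos φ + sin (α + φ) * sin φ := by
      rw [← cos_sub, add_sub_cancel_right]
    have hyc : cos y = cos φ := mul_left_cancel₀ hσ.ne' (by linarith)
    have hys : sin y = ε * sin φ := mul_left_cancel₀ hσ.ne' (by rw [hs] at h2; linarith)
    have hsc : cos s = cos α := by
      rw [← add_sub_cancel_right s y, cos_sub, hc, hs, hyc, hys, hcos]
      linear_combination sin (α + φ) * sin φ * hε
    have hss : sin s = ε * sin α := by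
      rw [← add_sub_cancel_right s y, sin_sub, hc, hs, hyc, hys, hsin]
      ring
    refine Fin.lastCases ⟨hyc, hys⟩ (fun i => ?_) j
    exact ih hn (fun j => x j.castSucc) (by linarith) hsc hss i

lemma eq_of_cos_eq_of_sin_eq {x y : ℝ} (hx : x ∈ Set.Icc (-π) π) (hy : y ∈ Set.Ioo (-π) π)
    (hc : cos x = cos y) (hs : sin x = sin y) : x = y := by
  obtain ⟨k, hk⟩ := Real.Angle.angle_eq_iff_two_pi_dvd_sub.1 (Real.Angle.cos_sin_inj hc hs)
  have hπ := pi_pos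
  have h1 : (k : ℝ) < 1 := by nlinarith [hx.2, hy.1]
  have h2 : (-1 : ℝ) < k := by nlinarith [hx.1, hy.2]
  have hk0 : k = 0 := by
    have : k < 1 := by exact_mod_cast h1
    have : -1 < k := by exact_mod_cast h2
    omega
  rw [hk0] at hk
  simp at hk
  linarith

lemma sq_add_sq_sub_two_mul_cos (α β : ℝ) :
    sin β ^ 2 + sin (α + β) ^ 2 - 2 * sin β * sin (α + β) * cos α = sin α ^ 2 := by
  rw [sin_add]
  linear_combination sin α ^ 2 * sin_sq_add_cos_sq β - sin β ^ 2 * sin_sq_add_cos_sq α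

lemma exp_mul_le_one {u t : ℝ} (hu : u ≤ 1 - t) (ht : 0 ≤ t) : exp u * t ≤ 1 :=
  calc exp u * t ≤ exp (1 - t) * exp (t - 1) :=
        mul_le_mul (exp_le_exp.2 hu) (by linarith [add_one_le_exp (t - 1)]) ht (exp_pos _).le
    _ = 1 := by rw [← exp_add]; simp

lemma eq_one_and_eq_zero_of_exp_mul_eq_one {u t : ℝ} (hu : u ≤ 1 - t) (he : exp u * t = 1) :
    t = 1 ∧ u = 0 := by
  have ht : t = 1 := by
    by_contra hne
    have hlt : t < exp (t - 1) := by
      linarith [add_one_lt_exp (x := t - 1) (sub_ne_zero.2 hne)]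
    have : exp u * t < 1 :=
      calc exp u * t < exp u * exp (t - 1) := mul_lt_mul_of_pos_left hlt (exp_pos _)
        _ = exp (u + (t - 1)) := (exp_add _ _).symm
        _ ≤ 1 := exp_le_one_iff.2 (by linarith)
    exact this.ne he
  refine ⟨ht, ?_⟩
  rw [ht, mul_one] at he
  exact exp_eq_one_iff u |>.1 he

/-- The function `h` attains its global maximum on `[−π,π]^r` exactly at the two
points `(φ,…,φ)` and `(−φ,…,−φ)`. -/
theorem stmt_1 (r : ℕ) (hr : 1 ≤ r) (φ : ℝ) (hφ1 : 0 < φ) (hφ2 : φ < π / ((r : ℝ) + 1))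
    (h : (Fin r → ℝ) → ℝ)
    (hh : ∀ x : Fin r → ℝ, h x =
      Real.exp (2 * (Real.sin (((r : ℝ) + 1) * φ) / Real.sin ((r : ℝ) * φ)) *
          ∑ j, Real.cos (x j)) *
        (Real.sin φ ^ 2 + Real.sin (((r : ℝ) + 1) * φ) ^ 2 -
          2 * Real.sin φ * Real.sin (((r : ℝ) + 1) * φ) * Real.cos (∑ j, x j))) :
    (∀ x : Fin r → ℝ, (∀ j, x j ∈ Set.Icc (-π) π) → h x ≤ h (fun _ => φ)) ∧
    h (fun _ => φ) = h (fun _ => -φ) ∧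
    (∀ x : Fin r → ℝ, (∀ j, x j ∈ Set.Icc (-π) π) →
      (h x = h (fun _ => φ) ↔ x = (fun _ => φ) ∨ x = (fun _ => -φ))) := by
  obtain ⟨n, rfl⟩ : ∃ n, r = n + 1 := ⟨r - 1, by omega⟩
  have hn2 : (((n + 1 : ℕ) : ℝ) + 1) * φ < π := by
    rw [mul_comm]
    exact (lt_div_iff₀ (by positivity)).1 hφ2
  push_cast at hh hn2
  have hn : ((n : ℝ) + 1) * φ < π := by nlinarith
  have hφπ : φ < π := by nlinarith [mul_nonneg (Nat.cast_nonneg n : (0 : ℝ) ≤ n) hφ1.le]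
  have ha : 0 < sin φ := sin_pos_of_pos_of_lt_pi hφ1 hφπ
  have hd := sin_nat_succ_mul_pos hφ1 hn
  rw [add_one_mul ((n : ℝ) + 1) φ] at hh hn2
  have hbound := sum_cos_le hφ1 n hn
  have hrigid := fun ε hε => cos_sin_eq_of_sum_cos_eq (ε := ε) hφ1 hε n hn
  have hsumφ : (∑ _j : Fin (n + 1), φ) = ((n : ℝ) + 1) * φ := by simp
  have hsumcos : (∑ _j : Fin (n + 1), cos φ) = ((n : ℝ) + 1) * cos φ := by simp
  set α := ((n : ℝ) + 1) * φ with hα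
  have hb : 0 < sin (α + φ) := sin_pos_of_pos_of_lt_pi (by positivity) hn2
  have hQ := sq_add_sq_sub_two_mul_cos α φ
  have hmax : h (fun _ => φ)
      = exp (2 * (sin (α + φ) / sin α) * (((n : ℝ) + 1) * cos φ)) * sin α ^ 2 := by
    rw [hh, hsumcos, hsumφ, hQ]
  have hpos : 0 < h (fun _ => φ) := by rw [hmax]; positivity
  have hneg : h (fun _ => φ) = h (fun _ => -φ) := by
    simp only [hh, cos_neg, Finset.sum_neg_distrib]
  let t : (Fin (n + 1) → ℝ) → ℝ := fun x =>
    (sin φ ^ 2 + sin (α + φ) ^ 2 - 2 * sin φ * sin (α + φ) * cos (∑ j, x j)) / sin α ^ 2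
  let u : (Fin (n + 1) → ℝ) → ℝ := fun x =>
    2 * (sin (α + φ) / sin α) * (∑ j, cos (x j) - ((n : ℝ) + 1) * cos φ)
  have ht0 : ∀ x, 0 ≤ t x := fun x => by
    refine div_nonneg ?_ (by positivity)
    nlinarith [sq_nonneg (sin φ - sin (α + φ)), mul_pos ha hb, cos_le_one (∑ j, x j)]
  have htx : ∀ x, 1 - t x
      = 2 * (sin (α + φ) / sin α) * (sin φ / sin α * (cos (∑ j, x j) - cos α)) := fun x => by
    simp only [t]
    field_simp
    linear_combination -hQ
  have hut : ∀ x, u x ≤ 1 - t x := fun x => by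
    rw [htx]
    refine mul_le_mul_of_nonneg_left ?_ (by positivity)
    have := hbound x
    rw [mul_sub, div_mul_eq_mul_div _ _ (cos α)]
    linarith
  have hxu : ∀ x, h x = exp (u x) * t x * h (fun _ => φ) := fun x => by
    have hexp : exp (2 * (sin (α + φ) / sin α) * ∑ j, cos (x j))
        = exp (u x) * exp (2 * (sin (α + φ) / sin α) * (((n : ℝ) + 1) * cos φ)) := by
      rw [← exp_add]
      congr 1
      simp only [u]
      ring
    rw [hmax, hh, hexp]
    simp only [t]
    field_simp
  refine ⟨fun x _ => ?_, hneg, fun x hx => ⟨fun hxe => ?_, ?_⟩⟩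
  · rw [hxu x]
    exact mul_le_of_le_one_left hpos.le (exp_mul_le_one (hut x) (ht0 x))
  · rw [hxu x, mul_eq_right₀ hpos.ne'] at hxe
    obtain ⟨ht1, hu0⟩ := eq_one_and_eq_zero_of_exp_mul_eq_one (hut x) hxe
    have hcos : cos (∑ j, x j) = cos α := by
      have h1 := htx x
      rw [ht1, sub_self, eq_comm, mul_eq_zero_iff_left (by positivity),
        mul_eq_zero_iff_left (by positivity)] at h1
      linarith
    have hsum : ∑ j, cos (x j) = ((n : ℝ) + 1) * cos φ := by
      rw [mul_eq_zero_iff_left (by positivity)] at hu0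
      linarith
    have hsin : sin (∑ j, x j) = sin α ∨ sin (∑ j, x j) = -sin α := by
      rw [← sq_eq_sq_iff_eq_or_eq_neg, sin_sq, sin_sq, hcos]
    rcases hsin with hsin | hsin
    · left
      funext j
      obtain ⟨hc, hs⟩ := hrigid 1 (by norm_num) x hsum hcos (by linarith) j
      exact eq_of_cos_eq_of_sin_eq (hx j) ⟨by linarith, hφπ⟩ hc (by linarith)
    · right
      funext j
      obtain ⟨hc, hs⟩ := hrigid (-1) (by norm_num) x hsum hcos (by linarith) j
      exact eq_of_cos_eq_of_sin_eq (hx j) ⟨by linarith, by linarith⟩ (by rw [cos_neg, hc])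
        (by rw [sin_neg]; linarith)
  · rintro (rfl | rfl)
    · rfl
    · exact hneg.symm
end

section
/- For every integer r ≥ 1 and every φ with 0 < φ < π/(r+1), one has r · sin φ · cos((r+2)φ) < cos φ · sin(rφ); equivalently, cos φ − r sin φ cos((r+2)φ)/sin(rφ) > 0 (note that sin(rφ) > 0 on this range). -/
open Real

/-- The division-free form of `n * tan φ ≤ tan (n * φ)`, valid as long as `n * φ ≤ π`. -/
theorem nat_mul_sin_mul_cos_le (φ : ℝ) (hφ : 0 ≤ φ) (hc : 0 ≤ cos φ) (n : ℕ)
    (hn : (n : ℝ) * φ ≤ π) : (n : ℝ) * sin φ * cos (n * φ) ≤ cos φ * sin (n * φ) := by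
  induction n with
  | zero => simp
  | succ n ih =>
    push_cast at hn ⊢
    have hle : (n : ℝ) * φ ≤ π := by linarith
    have h := mul_nonneg hc (sub_nonneg.2 (ih hle))
    have hs : 0 ≤ ((n : ℝ) + 1) * sin φ ^ 2 * sin (n * φ) :=
      mul_nonneg (by positivity) (sin_nonneg_of_nonneg_of_le_pi (by positivity) hle)
    rw [add_one_mul (n : ℝ) φ, sin_add, cos_add]
    linear_combination h + hs

/-- For every integer `r ≥ 1` and `0 < φ < π/(r+1)`:
`r sin φ cos((r+2)φ) < cos φ sin(rφ)`; equivalently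
`cos φ − r sin φ cos((r+2)φ)/sin(rφ) > 0`. -/
theorem stmt_3 (r : ℕ) (hr : 1 ≤ r) (φ : ℝ) (hφ1 : 0 < φ) (hφ2 : φ < π / ((r : ℝ) + 1)) :
    (r : ℝ) * Real.sin φ * Real.cos (((r : ℝ) + 2) * φ) < Real.cos φ * Real.sin ((r : ℝ) * φ) ∧
    0 < Real.cos φ - (r : ℝ) * Real.sin φ * Real.cos (((r : ℝ) + 2) * φ) / Real.sin ((r : ℝ) * φ) := by
  have hr' : (1 : ℝ) ≤ r := by exact_mod_cast hr
  have hθ : ((r : ℝ) + 1) * φ < π := by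
    rw [mul_comm]
    exact (lt_div_iff₀ (by positivity)).1 hφ2
  have hφ : φ < π / 2 := by nlinarith
  have hc : 0 < cos φ := cos_pos_of_mem_Ioo ⟨by linarith, hφ⟩
  have hs : 0 < sin φ := sin_pos_of_pos_of_lt_pi hφ1 (by linarith)
  have hsθ : 0 < sin (((r : ℝ) + 1) * φ) := sin_pos_of_pos_of_lt_pi (by positivity) hθ
  have hsr : 0 < sin ((r : ℝ) * φ) :=
    sin_pos_of_pos_of_lt_pi (by positivity) (by linarith)
  have htan := nat_mul_sin_mul_cos_le φ hφ1.le hc.le (r + 1) (by push_cast; exact hθ.le)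
  push_cast at htan
  have main : (r : ℝ) * sin φ * cos (((r : ℝ) + 2) * φ) < cos φ * sin ((r : ℝ) * φ) := by
    have h := mul_nonneg hc.le (sub_nonneg.2 htan)
    have hpos : 0 < (r : ℝ) * sin φ ^ 2 * sin (((r : ℝ) + 1) * φ) := by positivity
    rw [show ((r : ℝ) + 2) * φ = (r + 1) * φ + φ by ring,
      show (r : ℝ) * φ = (r + 1) * φ - φ by ring, cos_add, sin_sub]
    linear_combination h + hpos
  exact ⟨main, sub_pos.2 ((div_lt_iff₀ hsr).2 main)⟩
end

section
/- Fix φ ∈ (0, π/(r+1)) and set A = sin((r+1)φ)/sin(rφ), s = ν_1 + … + ν_r, D(φ) = ( (1 − r sin φ cos((r+1)φ)/sin(rφ))² + (r sin φ sin((r+1)φ)/sin(rφ))² )^{−1/4}, and g(φ) = −(r/2 + s)φ − (1/2) arctan( −r sin φ sin((r+1)φ) / (sin(rφ) − r sin φ cos((r+1)φ)) ). Then, as n → ∞, F_n(n^r ρ(φ)) divided by ( (2/(2π)^{r/2}) · (sin(rφ)/(n sin((r+1)φ)))^{r/2 + s} · exp(n r A cos φ) · (−sin(rφ)/sin φ)^n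 · D(φ) ) minus cos( n (r A sin φ − (r+1)φ) + g(φ) ) tends to 0. -/
open Real Filter

lemma sqrt_le_tangent_sub_sq {M y : ℝ} (hy : 0 ≤ y) (hM : y ≤ M) :
    √y ≤ 1 + (y - 1) / 2 - (y - 1) ^ 2 / (2 * (√M + 1) ^ 2) := by
  have h1 : √y ^ 2 = y := Real.sq_sqrt hy
  have h2 : √y ≤ √M := Real.sqrt_le_sqrt hM
  have h0 := Real.sqrt_nonneg y
  have h3 : (y - 1) ^ 2 / (2 * (√M + 1) ^ 2) ≤ (√y - 1) ^ 2 / 2 := by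
    rw [div_le_div_iff₀ (by positivity) (by positivity)]
    have h4 : (√y + 1) ^ 2 ≤ (√M + 1) ^ 2 := by gcongr
    have h5 : (y - 1) ^ 2 = (√y - 1) ^ 2 * (√y + 1) ^ 2 := by
      rw [← mul_pow]; congr 1; linear_combination -h1
    rw [h5]
    nlinarith [mul_le_mul_of_nonneg_left h4 (sq_nonneg (√y - 1))]
  nlinarith

lemma sin_nat_mul_pos {φ : ℝ} (hφ : 0 < φ) {k : ℕ} (hk : 1 ≤ k) (h : k * φ < π) :
    0 < sin (k * φ) := by
  have : (0 : ℝ) < k := by exact_mod_cast hk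
  exact sin_pos_of_pos_of_lt_pi (by positivity) h

set_option maxHeartbeats 800000 in
/-- The first-order optimality inequality for adding one more angle, with quadratic slack. -/
lemma exists_slack_step {φ : ℝ} (hφ : 0 < φ) {k : ℕ} (hk : 1 ≤ k)
    (h : ((k + 1 : ℕ) : ℝ) * φ < π) :
    ∃ δ > 0, ∀ T α : ℝ, δ * (cos T - cos (k * φ)) ^ 2 ≤
      cos φ - cos α - sin φ / sin ((k + 1 : ℕ) * φ) * (cos ((k + 1 : ℕ) * φ) - cos (T + α))
        + sin φ / sin (k * φ) * (cos (k * φ) - cos T) := by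
  have hs1 : 0 < sin ((k + 1 : ℕ) * φ) := sin_nat_mul_pos hφ (by lia) h
  have hs0 : 0 < sin (k * φ) := sin_nat_mul_pos hφ hk (by push_cast at h; nlinarith)
  have hs : 0 < sin φ := by
    have := sin_nat_mul_pos hφ le_rfl (k := 1)
      (by push_cast at h ⊢; nlinarith [(by exact_mod_cast hk : (1 : ℝ) ≤ k)])
    simpa using this
  set s1 := sin ((k + 1 : ℕ) * φ) with hs1'
  set c1 := cos ((k + 1 : ℕ) * φ) with hc1'
  set s0 := sin (k * φ) with hs0'
  set c0 := cos (k * φ) with hc0'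
  have e1 : s1 = s0 * cos φ + c0 * sin φ := by
    rw [hs1', hs0', hc0', ← sin_add]; push_cast; ring_nf
  have e2 : c1 = c0 * cos φ - s0 * sin φ := by
    rw [hc1', hs0', hc0', ← cos_add]; push_cast; ring_nf
  have p0 : s0 ^ 2 + c0 ^ 2 = 1 := sin_sq_add_cos_sq _
  have pf : sin φ ^ 2 + cos φ ^ 2 = 1 := sin_sq_add_cos_sq _
  set κ := sin φ / s1 with hκ
  have hκ0 : 0 < κ := by positivity
  have hκs : κ * s1 = sin φ := by rw [hκ]; field_simp
  set Y := s0 / s1 with hY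
  have hY0 : 0 < Y := by positivity
  have hYs : Y * s1 = s0 := by rw [hY]; field_simp
  have hp : cos φ - κ * c1 = Y := by
    have : (cos φ - κ * c1 - Y) * s1 = 0 := by
      linear_combination -c1 * hκs - hYs + cos φ * e1 - sin φ * e2 + s0 * pf
    have := (mul_eq_zero.1 this).resolve_right hs1.ne'
    linarith
  have hX : 1 + κ ^ 2 - 2 * κ * c0 = Y ^ 2 := by
    have : (1 + κ ^ 2 - 2 * κ * c0 - Y ^ 2) * s1 ^ 2 = 0 := by
      have a1 : κ ^ 2 * s1 ^ 2 = sin φ ^ 2 := by rw [← hκs]; ring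
      have a2 : Y ^ 2 * s1 ^ 2 = s0 ^ 2 := by rw [← hYs]; ring
      have a3 : κ * c0 * s1 ^ 2 = sin φ * c0 * s1 := by rw [← hκs]; ring
      have : s1 ^ 2 + sin φ ^ 2 - 2 * (sin φ * c0 * s1) - s0 ^ 2 = 0 := by
        rw [e1]
        linear_combination (s0 ^ 2) * pf - sin φ ^ 2 * p0
      linear_combination this + a1 - a2 - 2 * a3
    have := (mul_eq_zero.1 this).resolve_right (by positivity)
    linarith
  have hκY : sin φ / s0 = κ / Y := by rw [hκ, hY]; field_simp
  set M := (1 + κ) ^ 2 / Y ^ 2 with hM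
  refine ⟨Y * ((2 * κ / Y ^ 2) ^ 2 / (2 * (√M + 1) ^ 2)), by positivity, fun T α => ?_⟩
  set X := 1 + κ ^ 2 - 2 * κ * cos T with hXd
  have hX0 : 0 ≤ X := by nlinarith [cos_le_one T, neg_one_le_cos T, sq_nonneg (1 - κ)]
  have hXM : X / Y ^ 2 ≤ M := by
    rw [hM]; gcongr; nlinarith [cos_le_one T, neg_one_le_cos T]
  have key := sqrt_le_tangent_sub_sq (y := X / Y ^ 2) (by positivity) hXM
  have hy1 : X / Y ^ 2 - 1 = (2 * κ / Y ^ 2) * (c0 - cos T) := by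
    field_simp; rw [hXd, ← hX]; ring
  have hpX : cos α - κ * cos (T + α) ≤ √X := by
    apply Real.le_sqrt_of_sq_le
    rw [cos_add, hXd]
    have e : (cos α - κ * (cos T * cos α - sin T * sin α)) ^ 2 +
        (sin α + κ * (-sin T * cos α - cos T * sin α)) ^ 2 = 1 + κ ^ 2 - 2 * κ * cos T := by
      linear_combination (1 + κ ^ 2 * (sin T ^ 2 + cos T ^ 2) - 2 * κ * cos T) *
        sin_sq_add_cos_sq α + κ ^ 2 * sin_sq_add_cos_sq T
    linarith [sq_nonneg (sin α + κ * (-sin T * cos α - cos T * sin α))]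
  have hsq : √X = Y * √(X / Y ^ 2) := by
    rw [Real.sqrt_div hX0, Real.sqrt_sq hY0.le]; field_simp
  rw [hy1] at key
  have k2 : √X ≤ Y * (1 + 2 * κ / Y ^ 2 * (c0 - cos T) / 2 -
    (2 * κ / Y ^ 2 * (c0 - cos T)) ^ 2 / (2 * (√M + 1) ^ 2)) := by rw [hsq]; gcongr
  have k3 : Y * (1 + 2 * κ / Y ^ 2 * (c0 - cos T) / 2 -
    (2 * κ / Y ^ 2 * (c0 - cos T)) ^ 2 / (2 * (√M + 1) ^ 2)) = Y + κ / Y * (c0 - cos T) -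
      Y * ((2 * κ / Y ^ 2) ^ 2 / (2 * (√M + 1) ^ 2)) * (cos T - c0) ^ 2 := by
    have : Y * (2 * κ / Y ^ 2 * (c0 - cos T) / 2) = κ / Y * (c0 - cos T) := by field_simp
    rw [← this]; ring
  rw [hκY]
  linarith

lemma exists_uniform_slack_step {φ : ℝ} (hφ : 0 < φ) (N : ℕ) (h : (N : ℝ) * φ < π) :
    ∃ δ > 0, ∀ k : ℕ, 1 ≤ k → k + 1 ≤ N → ∀ T α : ℝ, δ * (cos T - cos (k * φ)) ^ 2 ≤
      cos φ - cos α - sin φ / sin ((k + 1 : ℕ) * φ) * (cos ((k + 1 : ℕ) * φ) - cos (T + α))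
        + sin φ / sin (k * φ) * (cos (k * φ) - cos T) := by
  induction N with
  | zero => exact ⟨1, one_pos, fun k h1 h2 => by lia⟩
  | succ N ih =>
    obtain ⟨δ, hδ, H⟩ := ih (by push_cast at h; nlinarith)
    rcases Nat.eq_zero_or_pos N with rfl | hN
    · exact ⟨1, one_pos, fun k h1 h2 => by lia⟩
    obtain ⟨δ', hδ', H'⟩ := exists_slack_step hφ hN h
    refine ⟨min δ δ', by positivity, fun k h1 h2 T α => ?_⟩
    rcases Nat.lt_or_ge k N with hk | hk
    · exact (mul_le_mul_of_nonneg_right (min_le_left _ _) (sq_nonneg _)).trans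
        (H k h1 hk T α)
    · obtain rfl : k = N := by lia
      exact (mul_le_mul_of_nonneg_right (min_le_right _ _) (sq_nonneg _)).trans (H' T α)

/-- The defect in the inequality
`∑ cos θ_j - (sin φ / sin kφ) cos (∑ θ_j) ≤ k cos φ - (sin φ / sin kφ) cos kφ`, `k = t.card`. -/
noncomputable def cosSlack {ι : Type*} (φ : ℝ) (θ : ι → ℝ) (t : Finset ι) : ℝ :=
  t.card * cos φ - ∑ j ∈ t, cos (θ j) -
    sin φ / sin (t.card * φ) * (cos (t.card * φ) - cos (∑ j ∈ t, θ j))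

lemma cosSlack_singleton {ι : Type*} {φ : ℝ} (hφ : sin φ ≠ 0) (θ : ι → ℝ) (j : ι) :
    cosSlack φ θ {j} = 0 := by
  simp [cosSlack, hφ]

section
variable {ι : Type*} [DecidableEq ι] {φ δ : ℝ} {N : ℕ}

lemma cosSlack_insert {θ : ι → ℝ} {t : Finset ι} {j : ι} (hj : j ∉ t) (ht : t.Nonempty)
    (hN : t.card + 1 ≤ N)
    (H : ∀ k : ℕ, 1 ≤ k → k + 1 ≤ N → ∀ T α : ℝ, δ * (cos T - cos (k * φ)) ^ 2 ≤
      cos φ - cos α - sin φ / sin ((k + 1 : ℕ) * φ) * (cos ((k + 1 : ℕ) * φ) - cos (T + α))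
        + sin φ / sin (k * φ) * (cos (k * φ) - cos T)) :
    cosSlack φ θ t + δ * (cos (∑ i ∈ t, θ i) - cos (t.card * φ)) ^ 2 ≤
      cosSlack φ θ (insert j t) := by
  have := H t.card ht.card_pos hN (∑ i ∈ t, θ i) (θ j)
  unfold cosSlack
  rw [Finset.card_insert_of_notMem hj, Finset.sum_insert hj, Finset.sum_insert hj,
    add_comm (θ j)]
  push_cast at this ⊢
  linarith

lemma cosSlack_le_union (hδ : 0 ≤ δ) {θ : ι → ℝ} {t : Finset ι} (ht : t.Nonempty)
    (H : ∀ k : ℕ, 1 ≤ k → k + 1 ≤ N → ∀ T α : ℝ, δ * (cos T - cos (k * φ)) ^ 2 ≤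
      cos φ - cos α - sin φ / sin ((k + 1 : ℕ) * φ) * (cos ((k + 1 : ℕ) * φ) - cos (T + α))
        + sin φ / sin (k * φ) * (cos (k * φ) - cos T))
    (v : Finset ι) (hN : (t ∪ v).card ≤ N) :
    cosSlack φ θ t ≤ cosSlack φ θ (t ∪ v) := by
  induction v using Finset.induction_on with
  | empty => simp
  | insert a v ha ih =>
    rw [Finset.union_insert] at hN ⊢
    have ih' := ih ((Finset.card_le_card (Finset.subset_insert _ _)).trans hN)
    by_cases hm : a ∈ t ∪ v
    · rwa [Finset.insert_eq_of_mem hm]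
    · rw [Finset.card_insert_of_notMem hm] at hN
      have := cosSlack_insert (θ := θ) hm (ht.mono Finset.subset_union_left) hN H
      nlinarith [mul_nonneg hδ (sq_nonneg (cos (∑ i ∈ t ∪ v, θ i) - cos ((t ∪ v).card * φ)))]

lemma cosSlack_nonneg (hφ : sin φ ≠ 0) (hδ : 0 ≤ δ) {θ : ι → ℝ} {t : Finset ι} (ht : t.Nonempty)
    (hN : t.card ≤ N)
    (H : ∀ k : ℕ, 1 ≤ k → k + 1 ≤ N → ∀ T α : ℝ, δ * (cos T - cos (k * φ)) ^ 2 ≤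
      cos φ - cos α - sin φ / sin ((k + 1 : ℕ) * φ) * (cos ((k + 1 : ℕ) * φ) - cos (T + α))
        + sin φ / sin (k * φ) * (cos (k * φ) - cos T)) :
    0 ≤ cosSlack φ θ t := by
  obtain ⟨a, ha⟩ := ht
  have hu : {a} ∪ t = t := Finset.union_eq_right.2 (by simpa using ha)
  have := cosSlack_le_union (θ := θ) hδ (Finset.singleton_nonempty a) H t (by rwa [hu])
  rwa [hu, cosSlack_singleton hφ] at this

end

/-- The function whose `n`-th power is integrated over the box `[-π, π]^r` of angles. -/
noncomputable def phase {ι : Type*} [Fintype ι] (A c : ℝ) (θ : ι → ℝ) : ℂ :=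
  Complex.exp (A * ∑ j, Complex.exp (θ j * Complex.I)) *
    (1 - c * Complex.exp (-(∑ j, (θ j : ℂ)) * Complex.I))

lemma norm_phase {ι : Type*} [Fintype ι] (A c : ℝ) (θ : ι → ℝ) :
    ‖phase A c θ‖ = exp (A * ∑ j, cos (θ j)) * √(1 + c ^ 2 - 2 * c * cos (∑ j, θ j)) := by
  rw [phase, norm_mul, Complex.norm_exp]
  congr 2
  · rw [Complex.re_ofReal_mul, Complex.re_sum]
    simp [Complex.exp_ofReal_mul_I_re]
  · have : -(∑ j, (θ j : ℂ)) * Complex.I = ((-∑ j, θ j : ℝ) : ℂ) * Complex.I := by push_cast; ring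
    rw [this, Complex.norm_def, Complex.normSq_apply]
    congr 1
    simp only [Complex.sub_re, Complex.one_re, Complex.re_ofReal_mul, Complex.exp_ofReal_mul_I_re,
      Complex.sub_im, Complex.one_im, Complex.im_ofReal_mul, Complex.exp_ofReal_mul_I_im, cos_neg,
      sin_neg]
    linear_combination c ^ 2 * sin_sq_add_cos_sq (∑ j, θ j)

set_option maxHeartbeats 800000 in
/-- Global decay of the phase, in terms of all partial sums of the angles. -/
lemma exists_norm_phase_le {r : ℕ} (hr : 1 ≤ r) {φ : ℝ} (hφ1 : 0 < φ)
    (hφ2 : ((r + 1 : ℕ) : ℝ) * φ < π) {A c : ℝ}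
    (hA : A = sin ((r + 1 : ℕ) * φ) / sin (r * φ)) (hc : c = sin ((r + 1 : ℕ) * φ) / sin φ) :
    ∃ δ > 0, ∀ θ : Fin r → ℝ, ∃ L : ℝ,
      ‖phase A c θ‖ ≤ exp (r * A * cos φ) * (sin (r * φ) / sin φ) * exp (-L) ∧
      ∀ t : Finset (Fin r), t.Nonempty →
        δ * (cos (∑ j ∈ t, θ j) - cos (t.card * φ)) ^ 2 ≤ L := by
  have hr' : (1 : ℝ) ≤ r := by exact_mod_cast hr
  have hrφ : (r : ℝ) * φ < π := by push_cast at hφ2; linarith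
  have hs1 : 0 < sin ((r + 1 : ℕ) * φ) := sin_nat_mul_pos hφ1 (by lia) hφ2
  have hs0 : 0 < sin (r * φ) := sin_nat_mul_pos hφ1 hr hrφ
  have hs : 0 < sin φ := sin_pos_of_pos_of_lt_pi hφ1 (by nlinarith)
  have hA0 : 0 < A := by rw [hA]; positivity
  have hc0 : 0 < c := by rw [hc]; positivity
  obtain ⟨δ, hδ, H⟩ := exists_uniform_slack_step hφ1 r hrφ
  set κ := sin φ / sin (r * φ) with hκ
  have hκ0 : 0 < κ := by positivity
  have hcA : c * κ = A := by rw [hc, hκ, hA]; field_simp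
  have hX0 : κ ^ 2 * (1 + c ^ 2 - 2 * c * cos (r * φ)) = 1 := by
    have e1 : sin ((r + 1 : ℕ) * φ) = sin (r * φ) * cos φ + cos (r * φ) * sin φ := by
      rw [← sin_add]; push_cast; ring_nf
    rw [hκ, hc]
    field_simp
    rw [mul_comm φ, e1]
    linear_combination (sin (r * φ) ^ 2) * sin_sq_add_cos_sq φ -
      sin φ ^ 2 * sin_sq_add_cos_sq (r * φ)
  set M := κ ^ 2 * (1 + c) ^ 2 with hM
  set δ1 := (2 * A * κ) ^ 2 / (2 * (√M + 1) ^ 2) with hδ1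
  have hδ1' : 0 < δ1 := by positivity
  have : Nonempty (Fin r) := ⟨⟨0, hr⟩⟩
  refine ⟨min (A * δ) δ1, by positivity, fun θ => ?_⟩
  set T := ∑ j, θ j with hT
  refine ⟨A * cosSlack φ θ Finset.univ + δ1 * (cos T - cos (r * φ)) ^ 2, ?_, fun t ht => ?_⟩
  · set y := κ ^ 2 * (1 + c ^ 2 - 2 * c * cos T) with hy
    have hX : 0 ≤ 1 + c ^ 2 - 2 * c * cos T := by
      nlinarith [cos_le_one T, sq_nonneg (1 - c)]
    have hyM : y ≤ M := by
      rw [hy, hM]; gcongr; nlinarith [neg_one_le_cos T]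
    have hsq := sqrt_le_tangent_sub_sq (y := y) (by positivity) hyM
    have hy1 : y - 1 = 2 * A * κ * (cos (r * φ) - cos T) := by
      rw [hy, ← hcA]; linear_combination hX0
    have hsq' : √y = κ * √(1 + c ^ 2 - 2 * c * cos T) := by
      rw [hy, Real.sqrt_mul (by positivity), Real.sqrt_sq hκ0.le]
    have hexp : √y ≤ exp (A * κ * (cos (r * φ) - cos T) - δ1 * (cos T - cos (r * φ)) ^ 2) := by
      refine le_trans ?_ (Real.add_one_le_exp _)
      have e : (y - 1) ^ 2 / (2 * (√M + 1) ^ 2) = δ1 * (cos T - cos (r * φ)) ^ 2 := by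
        rw [hδ1, hy1]; ring
      rw [e, hy1] at hsq
      linarith
    rw [norm_phase]
    have hκi : sin (r * φ) / sin φ = κ⁻¹ := by rw [hκ, inv_div]
    have hsX : √(1 + c ^ 2 - 2 * c * cos T) = κ⁻¹ * √y := by rw [hsq']; field_simp
    rw [hsX, hκi]
    calc exp (A * ∑ j, cos (θ j)) * (κ⁻¹ * √y)
        ≤ exp (A * ∑ j, cos (θ j)) * (κ⁻¹ *
          exp (A * κ * (cos (r * φ) - cos T) - δ1 * (cos T - cos (r * φ)) ^ 2)) := by gcongr
      _ = κ⁻¹ * exp (A * ∑ j, cos (θ j) +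
          (A * κ * (cos (r * φ) - cos T) - δ1 * (cos T - cos (r * φ)) ^ 2)) := by
        rw [Real.exp_add]; ring
      _ = κ⁻¹ * exp (r * A * cos φ +
          -(A * cosSlack φ θ Finset.univ + δ1 * (cos T - cos (r * φ)) ^ 2)) := by
        congr 2
        simp only [cosSlack, Finset.card_univ, Fintype.card_fin, ← hT, ← hκ]
        ring
      _ = _ := by rw [Real.exp_add]; ring
  · have hS0 : 0 ≤ cosSlack φ θ Finset.univ :=
      cosSlack_nonneg hs.ne' hδ.le Finset.univ_nonempty (by simp) H
    by_cases htu : t = Finset.univ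
    · subst htu
      simp only [Finset.card_univ, Fintype.card_fin, ← hT]
      have := mul_le_mul_of_nonneg_right (min_le_right (A * δ) δ1)
        (sq_nonneg (cos T - cos (r * φ)))
      have := mul_nonneg hA0.le hS0
      linarith
    · obtain ⟨j, hj⟩ : ∃ j, j ∉ t := by
        by_contra! h; exact htu (Finset.eq_univ_iff_forall.2 h)
      have hcard : (insert j t).card ≤ r := by simpa using Finset.card_le_univ (insert j t)
      have h1 := cosSlack_insert (θ := θ) hj ht
        (by rwa [Finset.card_insert_of_notMem hj] at hcard) H
      have h2 := cosSlack_le_union (θ := θ) hδ.le (Finset.insert_nonempty j t) H Finset.univ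
        ((Finset.card_le_univ _).trans (by simp))
      rw [Finset.union_eq_right.2 (Finset.subset_univ _)] at h2
      have h3 := cosSlack_nonneg (θ := θ) hs.ne' hδ.le ht
        ((Finset.card_le_card (Finset.subset_insert j t)).trans hcard) H
      have h4 : δ * (cos (∑ i ∈ t, θ i) - cos (t.card * φ)) ^ 2 ≤
        cosSlack φ θ Finset.univ := by linarith
      have h5 := mul_le_mul_of_nonneg_left h4 hA0.le
      have h6 := mul_le_mul_of_nonneg_right (min_le_left (A * δ) δ1)
        (sq_nonneg (cos (∑ i ∈ t, θ i) - cos (t.card * φ)))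
      have h7 : 0 ≤ δ1 * (cos T - cos (r * φ)) ^ 2 := by positivity
      linarith

lemma exists_sq_sub_le_sq_cos_sub {φ : ℝ} (h0 : 0 < φ) (h1 : φ < π) :
    ∃ δ > 0, ∀ θ ∈ Set.Icc 0 π, δ * (θ - φ) ^ 2 ≤ (cos θ - cos φ) ^ 2 := by
  have hsφ : 0 < sin (φ / 2) := sin_pos_of_pos_of_lt_pi (by linarith) (by linarith)
  have hcφ : 0 < cos (φ / 2) := cos_pos_of_mem_Ioo ⟨by linarith, by linarith⟩
  set m := min (sin (φ / 2)) (cos (φ / 2)) with hm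
  have hm0 : 0 < m := lt_min hsφ hcφ
  refine ⟨(2 / π * m) ^ 2, by positivity, fun θ hθ => ?_⟩
  have hsθ : 0 ≤ sin (θ / 2) :=
    sin_nonneg_of_nonneg_of_le_pi (by linarith [hθ.1]) (by linarith [hθ.1, hθ.2])
  have hcθ : 0 ≤ cos (θ / 2) := cos_nonneg_of_mem_Icc ⟨by linarith [hθ.1], by linarith [hθ.2]⟩
  have h2 : m ≤ sin ((θ + φ) / 2) := by
    have e : sin ((θ + φ) / 2) = sin (θ / 2) * cos (φ / 2) + cos (θ / 2) * sin (φ / 2) := by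
      rw [← sin_add]; ring_nf
    have : 1 ≤ sin (θ / 2) + cos (θ / 2) := by
      nlinarith [sin_sq_add_cos_sq (θ / 2), mul_nonneg hsθ hcθ]
    rw [e]
    nlinarith [mul_le_mul_of_nonneg_left (min_le_right (sin (φ / 2)) (cos (φ / 2))) hsθ,
      mul_le_mul_of_nonneg_left (min_le_left (sin (φ / 2)) (cos (φ / 2))) hcθ]
  have h3 : (2 / π * |(θ - φ) / 2|) ^ 2 ≤ sin ((θ - φ) / 2) ^ 2 := by
    rw [← sq_abs (sin _)]
    gcongr
    exact mul_abs_le_abs_sin (abs_le.2 ⟨by linarith [hθ.1], by linarith [hθ.2]⟩)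
  rw [mul_pow, sq_abs] at h3
  rw [cos_sub_cos]
  calc (2 / π * m) ^ 2 * (θ - φ) ^ 2
      = 4 * m ^ 2 * ((2 / π) ^ 2 * ((θ - φ) / 2) ^ 2) := by ring
    _ ≤ 4 * sin ((θ + φ) / 2) ^ 2 * sin ((θ - φ) / 2) ^ 2 := by gcongr
    _ = (-2 * sin ((θ + φ) / 2) * sin ((θ - φ) / 2)) ^ 2 := by ring

/-- Closeness of `cos a`, `cos b`, `cos (a + b)` to the values at `φ` forces `b` close to `φ`
when `a` lies in the upper half circle. -/
lemma exists_sq_sub_le_of_pair {φ : ℝ} (h0 : 0 < φ) (h1 : φ < π) :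
    ∃ δ > 0, ∀ a ∈ Set.Icc 0 π, ∀ b ∈ Set.Icc (-π) π, ∀ L : ℝ, (cos a - cos φ) ^ 2 ≤ L →
      (cos b - cos φ) ^ 2 ≤ L → (cos (a + b) - cos (2 * φ)) ^ 2 ≤ L → δ * (b - φ) ^ 2 ≤ L := by
  obtain ⟨δ, hδ, H⟩ := exists_sq_sub_le_sq_cos_sub h0 h1
  have hs : 0 < sin φ := sin_pos_of_pos_of_lt_pi h0 h1
  refine ⟨min δ (sin φ ^ 4 / 9 / (2 * π) ^ 2), by positivity, fun a ha b hb L hL1 hL2 hL3 => ?_⟩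
  rcases le_or_gt 0 b with hb0 | hb0
  · exact (mul_le_mul_of_nonneg_right (min_le_left _ _) (sq_nonneg _)).trans
      ((H b ⟨hb0, hb.2⟩).trans hL2)
  · have hsb : sin b ≤ 0 := sin_nonpos_of_nonpos_of_neg_pi_le hb0.le hb.1
    have hsa : 0 ≤ sin a := sin_nonneg_of_nonneg_of_le_pi ha.1 ha.2
    have hL : 0 ≤ L := (sq_nonneg _).trans hL1
    have k1 := abs_le.1 (Real.abs_le_sqrt hL1)
    have k2 := abs_le.1 (Real.abs_le_sqrt hL2)
    have k3 := abs_le.1 (Real.abs_le_sqrt hL3)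
    have k4 : |cos a * cos b - cos φ * cos φ| ≤ 2 * √L := by
      have : cos a * cos b - cos φ * cos φ =
        (cos a - cos φ) * cos b + cos φ * (cos b - cos φ) := by ring
      rw [this]
      refine (abs_add_le _ _).trans ?_
      rw [abs_mul, abs_mul]
      have := Real.abs_le_sqrt hL1
      have := Real.abs_le_sqrt hL2
      nlinarith [abs_cos_le_one b, abs_cos_le_one φ, abs_nonneg (cos a - cos φ),
        abs_nonneg (cos b - cos φ)]
    have k5 : sin φ ^ 2 ≤ 3 * √L := by
      rw [cos_add, cos_two_mul] at k3
      nlinarith [sin_sq_add_cos_sq φ, abs_le.1 k4, mul_nonneg hsa (neg_nonneg.2 hsb)]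
    have k6 : sin φ ^ 4 / 9 ≤ L := by
      have := pow_le_pow_left₀ (sq_nonneg _) k5 2
      rw [mul_pow, Real.sq_sqrt hL] at this
      nlinarith
    refine (mul_le_mul_of_nonneg_right (min_le_right _ _) (sq_nonneg _)).trans ?_
    refine le_trans ?_ k6
    rw [div_mul_eq_mul_div, div_le_iff₀ (by positivity)]
    have : (b - φ) ^ 2 ≤ (2 * π) ^ 2 := by
      apply sq_le_sq'  <;> linarith [hb.1, hb.2]
    gcongr

lemma exists_norm_phase_le_gaussian {r : ℕ} (j₀ : Fin r) {φ : ℝ} (hφ1 : 0 < φ)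
    (hφ2 : ((r + 1 : ℕ) : ℝ) * φ < π) {A c : ℝ}
    (hA : A = sin ((r + 1 : ℕ) * φ) / sin (r * φ)) (hc : c = sin ((r + 1 : ℕ) * φ) / sin φ) :
    ∃ δ > 0, ∀ θ : Fin r → ℝ, (∀ j, θ j ∈ Set.Icc (-π) π) → 0 ≤ θ j₀ →
      ‖phase A c θ‖ ≤ exp (r * A * cos φ) * (sin (r * φ) / sin φ) *
        exp (-(δ * ∑ j, (θ j - φ) ^ 2)) := by
  have hr : 1 ≤ r := by have := j₀.2; lia
  have hr' : (1 : ℝ) ≤ r := by exact_mod_cast hr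
  have hφπ : φ < π := by push_cast at hφ2; nlinarith
  have hs0 : 0 < sin (r * φ) := sin_nat_mul_pos hφ1 hr (by push_cast at hφ2; linarith)
  have hs : 0 < sin φ := sin_pos_of_pos_of_lt_pi hφ1 hφπ
  obtain ⟨δ, hδ, H⟩ := exists_norm_phase_le hr hφ1 hφ2 hA hc
  obtain ⟨δ1, hδ1, H1⟩ := exists_sq_sub_le_sq_cos_sub hφ1 hφπ
  obtain ⟨δ2, hδ2, H2⟩ := exists_sq_sub_le_of_pair hφ1 hφπ
  refine ⟨δ * min δ1 δ2 / r, by positivity, fun θ hθ h0 => ?_⟩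
  obtain ⟨L, hL, HL⟩ := H θ
  refine hL.trans ?_
  gcongr
  have hsing : ∀ j, (cos (θ j) - cos φ) ^ 2 ≤ L / δ := fun j => by
    have := HL {j} (Finset.singleton_nonempty j)
    rw [le_div_iff₀ hδ]
    simpa [mul_comm] using this
  have hall : ∀ j, min δ1 δ2 * (θ j - φ) ^ 2 ≤ L / δ := fun j => by
    by_cases hj : j = j₀
    · subst hj
      exact (mul_le_mul_of_nonneg_right (min_le_left _ _) (sq_nonneg _)).trans
        ((H1 _ ⟨h0, (hθ j).2⟩).trans (hsing j))
    · refine (mul_le_mul_of_nonneg_right (min_le_right _ _) (sq_nonneg _)).trans ?_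
      refine H2 (θ j₀) ⟨h0, (hθ j₀).2⟩ (θ j) (hθ j) (L / δ) (hsing _) (hsing _) ?_
      have := HL {j₀, j} (Finset.insert_nonempty _ _)
      rw [Finset.sum_pair (Ne.symm hj), Finset.card_pair (Ne.symm hj)] at this
      rw [le_div_iff₀ hδ]
      simpa [mul_comm] using this
  have hsum := Finset.sum_le_sum fun j (_ : j ∈ Finset.univ) => hall j
  rw [← Finset.mul_sum, Finset.sum_const, Finset.card_univ, Fintype.card_fin, nsmul_eq_mul] at hsum
  rw [div_mul_eq_mul_div, div_le_iff₀ (by positivity)]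
  calc δ * min δ1 δ2 * ∑ j, (θ j - φ) ^ 2 = δ * (min δ1 δ2 * ∑ j, (θ j - φ) ^ 2) := by ring
    _ ≤ δ * (r * (L / δ)) := by gcongr
    _ = L * r := by field_simp

lemma integral_exp_circle {R : ℝ} (hR : 0 < R) (m : ℕ) :
    ∫ θ in Set.Icc (-π) π, Complex.exp (R * Complex.exp (θ * Complex.I)) *
      Complex.exp (-(m * θ) * Complex.I) = 2 * π * R ^ m / m.factorial := by
  have h := (Complex.differentiable_exp.diffContOnCl
    (s := Metric.ball 0 R)).circleIntegral_one_div_sub_center_pow_smul hR m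
  have hit : iteratedDeriv m Complex.exp 0 = 1 := by
    rw [iteratedDeriv_eq_iterate, Complex.iter_deriv_exp, Complex.exp_zero]
  rw [hit, circleIntegral] at h
  set f : ℝ → ℂ := fun θ => Complex.exp (R * Complex.exp (θ * Complex.I)) *
      Complex.exp (-(m * θ) * Complex.I) with hf
  have hR' : (R : ℂ) ≠ 0 := by exact_mod_cast hR.ne'
  have hint : ∀ θ : ℝ, deriv (circleMap 0 R) θ • (1 / (circleMap 0 R θ - 0) ^ (m + 1)) •
      Complex.exp (circleMap 0 R θ) = (Complex.I / R ^ m) * f θ := fun θ => by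
    have e : Complex.exp (-(m * θ) * Complex.I) = (Complex.exp (θ * Complex.I) ^ m)⁻¹ := by
      rw [← Complex.exp_nat_mul, ← Complex.exp_neg]; ring_nf
    have := Complex.exp_ne_zero (θ * Complex.I)
    simp only [deriv_circleMap, circleMap_zero, smul_eq_mul, sub_zero, hf, e]
    field_simp
    ring
  simp_rw [hint] at h
  rw [intervalIntegral.integral_const_mul] at h
  have hper : Function.Periodic f (2 * π) := fun θ => by
    have e1 : ((θ + 2 * π : ℝ) : ℂ) * Complex.I = θ * Complex.I + 2 * π * Complex.I := by
      push_cast; ring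
    have e2 : (-(m * ((θ + 2 * π : ℝ) : ℂ)) * Complex.I) =
      -(m * θ) * Complex.I - m * (2 * π * Complex.I) := by push_cast; ring
    simp only [hf, e1, e2]
    rw [Complex.exp_periodic, Complex.exp_periodic.sub_nat_mul_eq]
  have h2 := hper.intervalIntegral_add_eq 0 (-π)
  rw [zero_add, show -π + 2 * π = π by ring] at h2
  rw [h2, intervalIntegral.integral_of_le (by linarith [pi_pos])] at h
  rw [MeasureTheory.integral_Icc_eq_integral_Ioc]
  have hfac : (m.factorial : ℂ) ≠ 0 := by exact_mod_cast m.factorial_ne_zero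
  rw [smul_eq_mul, mul_one, div_mul_eq_mul_div, div_eq_div_iff (pow_ne_zero _ hR') hfac] at h
  rw [eq_div_iff hfac]
  refine mul_left_cancel₀ Complex.I_ne_zero ?_
  linear_combination h

lemma isCompact_box (r : ℕ) : IsCompact (Set.univ.pi fun _ : Fin r => Set.Icc (-π) π) :=
  isCompact_univ_pi fun _ => isCompact_Icc

lemma sum_eq_integral {r : ℕ} (ν : Fin r → ℕ) {R : ℝ} (hR : 0 < R) (x : ℝ) (n : ℕ) :
    (R : ℂ) ^ (∑ j, ν j) * (2 * π) ^ r * ∑ k ∈ Finset.range (n + 1),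
        ((n.choose k : ℂ) * (-x) ^ k / ∏ j, ((k + ν j).factorial : ℂ)) =
      ∫ θ in Set.univ.pi fun _ : Fin r => Set.Icc (-π) π,
        Complex.exp (R * ∑ j, Complex.exp (θ j * Complex.I)) *
          (1 - x / R ^ r * Complex.exp (-(∑ j, (θ j : ℂ)) * Complex.I)) ^ n *
          Complex.exp (-(∑ j, (ν j : ℂ) * θ j) * Complex.I) := by
  have hR' : (R : ℂ) ≠ 0 := by exact_mod_cast hR.ne'
  have hint : ∀ θ : Fin r → ℝ, Complex.exp (R * ∑ j, Complex.exp (θ j * Complex.I)) *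
          (1 - x / R ^ r * Complex.exp (-(∑ j, (θ j : ℂ)) * Complex.I)) ^ n *
          Complex.exp (-(∑ j, (ν j : ℂ) * θ j) * Complex.I) =
      ∑ k ∈ Finset.range (n + 1), ((n.choose k : ℂ) * (-x) ^ k / (R ^ r) ^ k) *
        ∏ j, (Complex.exp (R * Complex.exp (θ j * Complex.I)) *
          Complex.exp (-((k + ν j : ℕ) * θ j) * Complex.I)) := fun θ => by
    have e0 : (1 - x / R ^ r * Complex.exp (-(∑ j, (θ j : ℂ)) * Complex.I)) ^ n =
      ∑ k ∈ Finset.range (n + 1),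
        (-x / R ^ r * Complex.exp (-(∑ j, (θ j : ℂ)) * Complex.I)) ^ k * (n.choose k : ℂ) := by
      rw [sub_eq_neg_add, add_pow]
      simp [neg_div]
    rw [e0, Finset.mul_sum, Finset.sum_mul]
    refine Finset.sum_congr rfl fun k _ => ?_
    rw [Finset.prod_mul_distrib, ← Complex.exp_sum, ← Complex.exp_sum, ← Finset.mul_sum]
    have e1 : ∑ j, -(((k + ν j : ℕ) : ℂ) * θ j) * Complex.I =
      k * (-(∑ j, (θ j : ℂ)) * Complex.I) + -(∑ j, (ν j : ℂ) * θ j) * Complex.I := by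
      rw [← Finset.sum_mul, Finset.sum_neg_distrib]
      push_cast
      simp_rw [add_mul]
      rw [Finset.sum_add_distrib, ← Finset.mul_sum]
      ring
    rw [e1, Complex.exp_add, Complex.exp_nat_mul, mul_pow, div_pow]
    ring
  simp_rw [hint]
  rw [MeasureTheory.integral_finsetSum]
  · rw [Finset.mul_sum]
    refine Finset.sum_congr rfl fun k _ => ?_
    rw [MeasureTheory.integral_const_mul, MeasureTheory.volume_pi,
      MeasureTheory.Measure.restrict_pi_pi,
      MeasureTheory.integral_fintype_prod_eq_prod (𝕜 := ℂ) (fun j (t : ℝ) =>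
        Complex.exp (R * Complex.exp (t * Complex.I)) *
          Complex.exp (-((k + ν j : ℕ) * t) * Complex.I))]
    simp_rw [integral_exp_circle hR]
    rw [Finset.prod_div_distrib, Finset.prod_mul_distrib, Finset.prod_const, Finset.card_univ,
      Fintype.card_fin, Finset.prod_pow_eq_pow_sum, Finset.sum_add_distrib, Finset.sum_const,
      Finset.card_univ, Fintype.card_fin, smul_eq_mul, pow_add, pow_mul]
    field_simp
  · intro k _
    refine ContinuousOn.integrableOn_compact (isCompact_box r) (Continuous.continuousOn ?_)
    fun_prop

/-- An integral over the symmetric box of a function with `f (-θ) = conj (f θ)` is twice the real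
part of the integral over a half box. -/
lemma integral_box_eq_two_re {r : ℕ} (j₀ : Fin r) {f : (Fin r → ℝ) → ℂ} (hf : Continuous f)
    (hsymm : ∀ θ, f (-θ) = starRingEnd ℂ (f θ)) :
    ∫ θ in Set.univ.pi fun _ : Fin r => Set.Icc (-π) π, f θ =
      ((2 * (∫ θ in (Set.univ.pi fun _ : Fin r => Set.Icc (-π) π) ∩ {θ | 0 < θ j₀}, f θ).re : ℝ)
        : ℂ) := by
  set Ω : Set (Fin r → ℝ) := Set.univ.pi fun _ => Set.Icc (-π) π with hΩ
  have hΩm : MeasurableSet Ω := (isCompact_box r).isClosed.measurableSet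
  set P : Set (Fin r → ℝ) := {θ | 0 < θ j₀} with hP
  have hPm : MeasurableSet P := (isOpen_lt continuous_const (continuous_apply j₀)).measurableSet
  set Q : Set (Fin r → ℝ) := {θ | θ j₀ < 0} with hQ
  have hQm : MeasurableSet Q := (isOpen_lt (continuous_apply j₀) continuous_const).measurableSet
  have hint : MeasureTheory.IntegrableOn f Ω :=
    hf.continuousOn.integrableOn_compact (isCompact_box r)
  have hnull : MeasureTheory.volume {θ : Fin r → ℝ | θ j₀ = 0} = 0 := by
    have := MeasureTheory.Measure.pi_hyperplane
      (fun _ : Fin r => (MeasureTheory.volume : MeasureTheory.Measure ℝ)) j₀ 0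
    rwa [← MeasureTheory.volume_pi] at this
  have hsplit : ∫ θ in Ω, f θ = (∫ θ in Ω ∩ P, f θ) + ∫ θ in Ω ∩ Q, f θ := by
    rw [← MeasureTheory.setIntegral_union _ (hΩm.inter hQm)
      (hint.mono_set Set.inter_subset_left) (hint.mono_set Set.inter_subset_left)]
    · apply MeasureTheory.setIntegral_congr_set
      refine (MeasureTheory.ae_eq_set.2 ⟨?_, ?_⟩)
      · refine MeasureTheory.measure_mono_null (fun θ hθ => ?_) hnull
        simp only [Set.mem_sdiff, Set.mem_union, Set.mem_inter_iff, hP, hQ, Set.mem_ofPred_eq] at hθ ⊢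
        by_contra h
        rcases lt_or_gt_of_ne h with h | h
        · exact hθ.2 (Or.inr ⟨hθ.1, h⟩)
        · exact hθ.2 (Or.inl ⟨hθ.1, h⟩)
      · convert MeasureTheory.measure_empty (μ := MeasureTheory.volume)
        rw [Set.sdiff_eq_empty]
        exact Set.union_subset Set.inter_subset_left Set.inter_subset_left
    · refine Set.disjoint_left.2 fun θ h1 h2 => ?_
      exact lt_asymm (show 0 < θ j₀ from h1.2) (show θ j₀ < 0 from h2.2)
  have hneg : ∫ θ in Ω ∩ Q, f θ = starRingEnd ℂ (∫ θ in Ω ∩ P, f θ) := by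
    rw [← integral_conj, ← MeasureTheory.integral_indicator (hΩm.inter hQm),
      ← MeasureTheory.integral_indicator (hΩm.inter hPm),
      ← MeasureTheory.integral_neg_eq_self]
    congr 1
    ext θ
    have hmem : -θ ∈ Ω ∩ Q ↔ θ ∈ Ω ∩ P := by
      simp only [hΩ, hQ, hP, Set.mem_inter_iff, Set.mem_pi, Set.mem_univ, true_imp_iff,
        Set.mem_Icc, Pi.neg_apply, Set.mem_ofPred_eq, neg_lt_zero, neg_le_neg_iff]
      refine and_congr_left fun _ => forall_congr' fun j => ?_
      constructor <;> rintro ⟨h1, h2⟩ <;> constructor <;> linarith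
    by_cases h : θ ∈ Ω ∩ P
    · rw [Set.indicator_of_mem (hmem.2 h), Set.indicator_of_mem h, hsymm]
    · rw [Set.indicator_of_notMem (fun h' => h (hmem.1 h')), Set.indicator_of_notMem h]
  rw [hsplit, hneg, Complex.add_conj]

lemma tendsto_pow_of_second_order {f f' : ℝ → ℂ} {q : ℂ} (hf : ∀ t, HasDerivAt f (f' t) t)
    (hf' : HasDerivAt f' q 0) (h0 : f 0 = 1) (h0' : f' 0 = 0) :
    Tendsto (fun n : ℕ => f ((√n)⁻¹) ^ n) atTop (nhds (Complex.exp (q / 2))) := by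
  have key : (fun t : ℝ => (f t - 1 - q / 2 * t ^ 2)) =o[nhds 0] fun t => t ^ 2 := by
    have h1 : ∀ t : ℝ, HasDerivAt (fun t : ℝ => f t - q / 2 * t ^ 2) (f' t - q * t) t := fun t => by
      have h2 : HasDerivAt (fun t : ℝ => (t : ℂ)) 1 t := Complex.ofRealCLM.hasDerivAt
      convert! (hf t).sub ((h2.pow 2).const_mul (q / 2)) using 1
      simp; ring
    have := convex_univ.isLittleO_pow_succ_real (n := 1) (Set.mem_univ (0 : ℝ))
      (fun t _ => (h1 t).hasDerivWithinAt) (by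
        have := hasDerivAt_iff_isLittleO.1 hf'
        simp only [h0', sub_zero, Complex.real_smul] at this
        simpa [mul_comm] using this)
    simp only [nhdsWithin_univ] at this
    simpa [h0, sub_right_comm] using this
  have ht : Tendsto (fun n : ℕ => (√(n : ℝ))⁻¹) atTop (nhds 0) :=
    tendsto_inv_atTop_zero.comp (tendsto_sqrt_atTop.comp tendsto_natCast_atTop_atTop)
  have h2 := key.comp_tendsto ht
  have h3 : Tendsto (fun n : ℕ => (n : ℂ) * (f ((√n)⁻¹) - 1)) atTop (nhds (q / 2)) := by
    rw [tendsto_iff_norm_sub_tendsto_zero]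
    refine h2.norm_left.tendsto_div_nhds_zero.congr' ?_
    filter_upwards [eventually_ge_atTop 1] with n hn
    have hn0 : (0 : ℝ) < n := by exact_mod_cast hn
    have hsq : ((√(n : ℝ))⁻¹) ^ 2 = (n : ℝ)⁻¹ := by rw [inv_pow, sq_sqrt hn0.le]
    have hsq' : (((√(n : ℝ))⁻¹ : ℝ) : ℂ) ^ 2 = (n : ℂ)⁻¹ := by
      rw [← Complex.ofReal_pow, hsq]; push_cast; rfl
    simp only [Function.comp_apply]
    rw [hsq, hsq', div_inv_eq_mul, mul_comm]
    have hn1 : (n : ℂ) ≠ 0 := by exact_mod_cast hn0.ne'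
    generalize f _ = z
    rw [show n * (z - 1) - q / 2 = n * (z - 1 - q / 2 * (n : ℂ)⁻¹) by field_simp, norm_mul,
      Complex.norm_natCast]
  simpa using Complex.tendsto_one_add_pow_exp_of_tendsto h3

section saddle

variable {r : ℕ} {φ A c : ℝ}

lemma saddle_sub_one (hs0 : sin (r * φ) ≠ 0)
    (hA : A = sin ((r + 1 : ℕ) * φ) / sin (r * φ)) :
    (A : ℂ) * Complex.exp (φ * Complex.I) - 1 =
      ((sin φ / sin (r * φ) : ℝ) : ℂ) * Complex.exp (((r + 1 : ℕ) * φ : ℝ) * Complex.I) := by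
  have e1 : sin (r * φ) = sin ((r + 1 : ℕ) * φ) * cos φ - cos ((r + 1 : ℕ) * φ) * sin φ := by
    rw [← sin_sub]; push_cast; ring_nf
  apply Complex.ext
  · rw [Complex.sub_re, Complex.re_ofReal_mul, Complex.re_ofReal_mul, Complex.exp_ofReal_mul_I_re,
      Complex.exp_ofReal_mul_I_re, Complex.one_re, hA]
    rw [div_mul_eq_mul_div, div_mul_eq_mul_div, div_sub_one hs0, div_left_inj' hs0]
    linear_combination -e1
  · rw [Complex.sub_im, Complex.im_ofReal_mul, Complex.im_ofReal_mul, Complex.exp_ofReal_mul_I_im,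
      Complex.exp_ofReal_mul_I_im, Complex.one_im, hA]
    ring

lemma saddle_equation (hs : sin φ ≠ 0) (hs0 : sin (r * φ) ≠ 0)
    (hA : A = sin ((r + 1 : ℕ) * φ) / sin (r * φ)) (hc : c = sin ((r + 1 : ℕ) * φ) / sin φ) :
    (c : ℂ) * Complex.exp (-(r * φ) * Complex.I) * (A * Complex.exp (φ * Complex.I) - 1) =
      A * Complex.exp (φ * Complex.I) := by
  rw [saddle_sub_one hs0 hA]
  have e1 : Complex.exp (φ * Complex.I) = Complex.exp (-(r * φ) * Complex.I) *
      Complex.exp (((r + 1 : ℕ) * φ : ℝ) * Complex.I) := by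
    rw [← Complex.exp_add]; push_cast; ring_nf
  have e2 : (A : ℂ) = c * (sin φ / sin (r * φ) : ℝ) := by
    rw [← Complex.ofReal_mul, hA, hc]; congr 1; field_simp
  rw [e1, e2]; ring

lemma phase_saddle (hs : sin φ ≠ 0) (hs0 : sin (r * φ) ≠ 0)
    (hA : A = sin ((r + 1 : ℕ) * φ) / sin (r * φ)) (hc : c = sin ((r + 1 : ℕ) * φ) / sin φ) :
    phase A c (fun _ : Fin r => φ) =
      ((exp (r * A * cos φ) * (-sin (r * φ) / sin φ) : ℝ) : ℂ) *
        Complex.exp ((r * A * sin φ - (r + 1) * φ : ℝ) * Complex.I) := by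
  have h1 := saddle_equation hs hs0 hA hc
  have h2 := saddle_sub_one hs0 hA
  have hne : ((sin φ / sin (r * φ) : ℝ) : ℂ) ≠ 0 := by
    exact_mod_cast div_ne_zero hs hs0
  have hE := Complex.exp_ne_zero (((r + 1 : ℕ) * φ : ℝ) * Complex.I)
  have h3 : 1 - (c : ℂ) * Complex.exp (-(r * φ) * Complex.I) =
      ((-sin (r * φ) / sin φ : ℝ) : ℂ) * Complex.exp (-((r + 1) * φ : ℝ) * Complex.I) := by
    have h4 : (1 - (c : ℂ) * Complex.exp (-(r * φ) * Complex.I)) *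
      (A * Complex.exp (φ * Complex.I) - 1) = -1 := by linear_combination -h1
    rw [h2] at h4
    refine mul_right_cancel₀ (mul_ne_zero hne hE) ?_
    rw [h4]
    have e1 : Complex.exp (-((r + 1) * φ : ℝ) * Complex.I) *
        Complex.exp (((r + 1 : ℕ) * φ : ℝ) * Complex.I) = 1 := by
      rw [← Complex.exp_add, ← Complex.exp_zero]; push_cast; ring_nf
    have e2 : ((-sin (r * φ) / sin φ : ℝ) : ℂ) * (sin φ / sin (r * φ) : ℝ) = -1 := by
      rw [← Complex.ofReal_mul]
      rw [show -sin (r * φ) / sin φ * (sin φ / sin (r * φ)) = -1 by field_simp]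
      simp
    linear_combination (-1 : ℂ) * e2 -
      ((-sin (r * φ) / sin φ : ℝ) : ℂ) * (sin φ / sin (r * φ) : ℝ) * e1
  rw [phase]
  simp only [Finset.sum_const, Finset.card_univ, Fintype.card_fin, nsmul_eq_mul]
  rw [h3]
  have e4 : (A : ℂ) * (r * Complex.exp (φ * Complex.I)) =
      ((r * A * cos φ : ℝ) : ℂ) + (r * A * sin φ : ℝ) * Complex.I := by
    rw [Complex.exp_mul_I]; push_cast; ring
  rw [e4, Complex.exp_add, ← Complex.ofReal_exp]
  have e5 : ((r * A * sin φ - (r + 1) * φ : ℝ) : ℂ) * Complex.I =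
    (r * A * sin φ : ℝ) * Complex.I + -((r + 1) * φ : ℝ) * Complex.I := by push_cast; ring
  rw [e5, Complex.exp_add]
  push_cast
  ring

lemma phase_add_eq (hs : sin φ ≠ 0) (hs0 : sin (r * φ) ≠ 0)
    (hA : A = sin ((r + 1 : ℕ) * φ) / sin (r * φ)) (hc : c = sin ((r + 1 : ℕ) * φ) / sin φ)
    {w : ℂ} (hw : w = A * Complex.exp (φ * Complex.I)) (u : Fin r → ℝ) (t : ℝ) :
    phase A c (fun j => φ + t * u j) = phase A c (fun _ : Fin r => φ) *
      (Complex.exp (w * ∑ j, (Complex.exp (t * (u j * Complex.I)) - 1)) *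
        (1 + w * (Complex.exp (t * (-(∑ j, (u j : ℂ)) * Complex.I)) - 1))) := by
  have h1 := saddle_equation hs hs0 hA hc
  rw [← hw] at h1
  have e1 : (A : ℂ) * ∑ j, Complex.exp (((φ + t * u j : ℝ) : ℂ) * Complex.I) =
      A * ∑ _j : Fin r, Complex.exp (φ * Complex.I) +
        w * ∑ j, (Complex.exp (t * (u j * Complex.I)) - 1) := by
    rw [Finset.mul_sum, Finset.mul_sum, Finset.mul_sum, ← Finset.sum_add_distrib]
    refine Finset.sum_congr rfl fun j _ => ?_
    have : ((φ + t * u j : ℝ) : ℂ) * Complex.I = φ * Complex.I + t * (u j * Complex.I) := by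
      push_cast; ring
    rw [this, Complex.exp_add, hw]; ring
  have e2 : -(∑ j, ((φ + t * u j : ℝ) : ℂ)) * Complex.I =
      -(r * φ) * Complex.I + t * (-(∑ j, (u j : ℂ)) * Complex.I) := by
    push_cast
    rw [Finset.sum_add_distrib, ← Finset.mul_sum]
    simp only [Finset.sum_const, Finset.card_univ, Fintype.card_fin, nsmul_eq_mul]
    ring
  have e3 : -(∑ _j : Fin r, (φ : ℂ)) * Complex.I = -(r * φ) * Complex.I := by simp
  rw [phase, phase, e1, e2, e3, Complex.exp_add, Complex.exp_add]
  set E := (c : ℂ) * Complex.exp (-(r * φ) * Complex.I) with hE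
  set e := Complex.exp (t * (-(∑ j, (u j : ℂ)) * Complex.I))
  have : 1 - (c : ℂ) * (Complex.exp (-(r * φ) * Complex.I) * e) = (1 - E) * (1 + w * (e - 1)) := by
    rw [← mul_assoc, ← hE]; linear_combination (e - 1) * h1
  rw [this]; ring

lemma tendsto_phase_scaled (hs : sin φ ≠ 0) (hs0 : sin (r * φ) ≠ 0)
    (hA : A = sin ((r + 1 : ℕ) * φ) / sin (r * φ)) (hc : c = sin ((r + 1 : ℕ) * φ) / sin φ)
    {w : ℂ} (hw : w = A * Complex.exp (φ * Complex.I)) (u : Fin r → ℝ) :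
    Tendsto (fun n : ℕ => (phase A c (fun j => φ + (√n)⁻¹ * u j) /
        phase A c (fun _ : Fin r => φ)) ^ n) atTop
      (nhds (Complex.exp (-(w * ∑ j, (u j : ℂ) ^ 2 + (w - w ^ 2) * (∑ j, (u j : ℂ)) ^ 2) / 2))) := by
  have hne : phase A c (fun _ : Fin r => φ) ≠ 0 := by
    rw [phase_saddle hs hs0 hA hc]
    refine mul_ne_zero ?_ (Complex.exp_ne_zero _)
    exact_mod_cast mul_ne_zero (exp_pos _).ne' (div_ne_zero (neg_ne_zero.2 hs0) hs)
  simp_rw [phase_add_eq hs hs0 hA hc hw u, mul_div_cancel_left₀ _ hne]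
  have hexp : ∀ (z : ℂ) (t : ℝ), HasDerivAt (fun t : ℝ => Complex.exp (t * z))
      (z * Complex.exp (t * z)) t := fun z t => by
    have h2 : HasDerivAt (fun t : ℝ => (t : ℂ)) 1 t := Complex.ofRealCLM.hasDerivAt
    convert! (h2.mul_const z).cexp using 1
    ring
  set S := -(∑ j, (u j : ℂ)) * Complex.I with hS
  have ha : ∀ t : ℝ, HasDerivAt (fun t : ℝ => w * ∑ j, (Complex.exp (t * (u j * Complex.I)) - 1))
      (w * ∑ j, (u j * Complex.I) * Complex.exp (t * (u j * Complex.I))) t := fun t =>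
    (HasDerivAt.fun_sum fun j _ => (hexp _ t).sub_const 1).const_mul w
  have hb : ∀ t : ℝ, HasDerivAt (fun t : ℝ => 1 + w * (Complex.exp (t * S) - 1))
      (w * (S * Complex.exp (t * S))) t := fun t =>
    (((hexp _ t).sub_const 1).const_mul w).const_add 1
  have hf := fun t => (ha t).cexp.mul (hb t)
  have ha' : HasDerivAt
      (fun t : ℝ => w * ∑ j, (u j * Complex.I) * Complex.exp (t * (u j * Complex.I)))
      (w * ∑ j, (u j * Complex.I) * ((u j * Complex.I) *
        Complex.exp ((0 : ℝ) * (u j * Complex.I)))) 0 :=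
    (HasDerivAt.fun_sum fun j _ => (hexp _ 0).const_mul _).const_mul w
  have hb' : HasDerivAt (fun t : ℝ => w * (S * Complex.exp (t * S)))
      (w * (S * (S * Complex.exp ((0 : ℝ) * S)))) 0 := ((hexp _ 0).const_mul _).const_mul w
  have hf' := (((ha 0).cexp.mul ha').mul (hb 0)).add ((ha 0).cexp.mul hb')
  have := tendsto_pow_of_second_order hf hf' (by simp) (by
    simp [hS, ← Finset.sum_mul])
  convert! this using 3
  simp only [Complex.ofReal_zero, zero_mul, Complex.exp_zero, sub_self, Finset.sum_const_zero,
    mul_zero, add_zero, mul_one, one_mul, ← Finset.sum_mul, hS, Pi.mul_apply]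
  have hq : ∑ j, (u j : ℂ) * Complex.I * (u j * Complex.I) = -∑ j, (u j : ℂ) ^ 2 := by
    rw [← Finset.sum_neg_distrib]
    refine Finset.sum_congr rfl fun j _ => ?_
    linear_combination (u j : ℂ) ^ 2 * Complex.I_sq
  rw [hq]
  linear_combination -(w - w ^ 2) * (∑ j, (u j : ℂ)) ^ 2 / 2 * Complex.I_sq

end saddle

lemma integral_gaussian_sum_sq {r : ℕ} (j₀ : Fin r) {a b : ℂ} (ha : 0 < a.re)
    (hab : 0 < (a + r * b).re) :
    ∫ u : Fin r → ℝ, Complex.exp (-(a * ∑ j, (u j : ℂ) ^ 2 + b * (∑ j, (u j : ℂ)) ^ 2) / 2) =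
      ((2 * π / a : ℂ) ^ (1 / 2 : ℂ)) ^ (r - 1) * (2 * π / (a + r * b) : ℂ) ^ (1 / 2 : ℂ) := by
  have hr : (0 : ℝ) < r := by exact_mod_cast j₀.pos
  obtain ⟨B, hB⟩ : ∃ B : OrthonormalBasis (Fin r) ℝ (EuclideanSpace ℝ (Fin r)),
      B j₀ = WithLp.toLp 2 fun _ => (√r)⁻¹ := by
    have hv : Orthonormal ℝ (({j₀} : Set (Fin r)).domRestrict fun _ =>
        (WithLp.toLp 2 fun _ => (√r)⁻¹ : EuclideanSpace ℝ (Fin r))) := by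
      refine ⟨fun i => ?_, fun i j hij => (hij (Subsingleton.elim i j)).elim⟩
      rw [Set.domRestrict_apply, EuclideanSpace.norm_eq, sqrt_eq_one]
      simp [hr.ne']
    obtain ⟨B, hB⟩ := hv.exists_orthonormalBasis_extension_of_card_eq (by simp)
    exact ⟨B, hB j₀ rfl⟩
  have hsum : ∀ v : Fin r → ℝ, ∑ j, (B.repr.symm (WithLp.toLp 2 v)) j = √r * v j₀ := fun v => by
    have h1 := B.repr_apply_apply (B.repr.symm (WithLp.toLp 2 v)) j₀
    rw [B.repr.apply_symm_apply, hB] at h1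
    simp only [PiLp.inner_apply, RCLike.inner_apply, conj_trivial, ← Finset.sum_mul] at h1
    rw [h1]
    have : √(r : ℝ) ≠ 0 := (sqrt_pos.2 hr).ne'
    field_simp
  have hsq : ∀ v : Fin r → ℝ, ∑ j, (B.repr.symm (WithLp.toLp 2 v)) j ^ 2 = ∑ j, v j ^ 2 :=
    fun v => by
      have h1 := B.repr.symm.norm_map (WithLp.toLp 2 v)
      have h2 := congrArg (· ^ 2) h1
      simpa only [EuclideanSpace.real_norm_sq_eq] using h2
  rw [← (PiLp.volume_preserving_ofLp (Fin r)).integral_comp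
      (MeasurableEquiv.toLp 2 (Fin r → ℝ)).symm.measurableEmbedding,
    ← B.measurePreserving_repr_symm.integral_comp B.repr.symm.toHomeomorph.measurableEmbedding,
    ← (PiLp.volume_preserving_toLp (Fin r)).integral_comp
      (MeasurableEquiv.toLp 2 (Fin r → ℝ)).measurableEmbedding]
  have key : ∀ v : Fin r → ℝ,
      -(a * ∑ j, ((B.repr.symm (WithLp.toLp 2 v) j : ℝ) : ℂ) ^ 2 +
        b * (∑ j, ((B.repr.symm (WithLp.toLp 2 v) j : ℝ) : ℂ)) ^ 2) / 2 =
      -∑ j, (if j = j₀ then (a + r * b) / 2 else a / 2) * (v j : ℂ) ^ 2 + ∑ j, (0 : ℂ) * v j := by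
    intro v
    have e1 : ∑ j, ((B.repr.symm (WithLp.toLp 2 v) j : ℝ) : ℂ) ^ 2 = ∑ j, (v j : ℂ) ^ 2 := by
      exact_mod_cast hsq v
    have e2 : (∑ j, ((B.repr.symm (WithLp.toLp 2 v) j : ℝ) : ℂ)) ^ 2 = r * (v j₀ : ℂ) ^ 2 := by
      rw [← Complex.ofReal_sum, hsum, ← Complex.ofReal_pow, mul_pow, sq_sqrt hr.le]
      push_cast; rfl
    have e3 : ∀ j, (if j = j₀ then (a + r * b) / 2 else a / 2) * (v j : ℂ) ^ 2 =
        a / 2 * (v j : ℂ) ^ 2 + if j = j₀ then r * b / 2 * (v j : ℂ) ^ 2 else 0 := fun j => by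
      split_ifs <;> ring
    simp_rw [e1, e2, e3, Finset.sum_add_distrib, ← Finset.mul_sum]
    simp
    ring
  simp_rw [key]
  rw [GaussianFourier.integral_cexp_neg_sum_mul_add]
  · simp only [ne_eq, OfNat.ofNat_ne_zero, not_false_eq_true, zero_pow, zero_div,
      Complex.exp_zero, mul_one]
    rw [← Finset.mul_prod_erase _ _ (Finset.mem_univ j₀), mul_comm]
    have : ∏ x ∈ Finset.univ.erase j₀,
        ((π : ℂ) / if x = j₀ then (a + r * b) / 2 else a / 2) ^ (1 / 2 : ℂ) =
        ∏ x ∈ Finset.univ.erase j₀, (2 * π / a : ℂ) ^ (1 / 2 : ℂ) :=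
      Finset.prod_congr rfl fun x hx => by
        rw [if_neg (Finset.ne_of_mem_erase hx), div_div_eq_mul_div, mul_comm]
    rw [this, Finset.prod_const, Finset.card_erase_of_mem (Finset.mem_univ _), if_pos rfl,
      div_div_eq_mul_div, mul_comm (π : ℂ)]
    simp
  · intro i
    split_ifs
    · rw [← Complex.ofReal_ofNat, Complex.div_ofReal_re]; positivity
    · rw [← Complex.ofReal_ofNat, Complex.div_ofReal_re]; positivity

section laplace

variable {r : ℕ} {H : Set (Fin r → ℝ)} {p : Fin r → ℝ} {f : (Fin r → ℝ) → ℂ} {δ : ℝ}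

lemma tendsto_add_inv_sqrt_smul (p u : Fin r → ℝ) :
    Tendsto (fun n : ℕ => p + (√n)⁻¹ • u) atTop (nhds p) := by
  have ht : Tendsto (fun n : ℕ => (√(n : ℝ))⁻¹) atTop (nhds 0) :=
    tendsto_inv_atTop_zero.comp (tendsto_sqrt_atTop.comp tendsto_natCast_atTop_atTop)
  simpa using (ht.smul_const u).const_add p

lemma norm_pow_le_of_gaussian
    (hfb : ∀ θ ∈ H, ‖f θ‖ ≤ exp (-(δ * ∑ j, (θ j - p j) ^ 2))) {n : ℕ} (hn : 1 ≤ n)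
    {u : Fin r → ℝ} (hu : p + (√n)⁻¹ • u ∈ H) :
    ‖f (p + (√n)⁻¹ • u) ^ n‖ ≤ exp (-(δ * ∑ j, u j ^ 2)) := by
  have hn0 : (0 : ℝ) < n := by exact_mod_cast hn
  rw [norm_pow]
  refine (pow_le_pow_left₀ (norm_nonneg _) (hfb _ hu) n).trans_eq ?_
  rw [← exp_nat_mul]
  congr 1
  simp only [Pi.add_apply, Pi.smul_apply, smul_eq_mul, add_sub_cancel_left, mul_pow, inv_pow,
    sq_sqrt hn0.le, ← Finset.mul_sum]
  field_simp

lemma norm_limit_le_of_gaussian (hp : H ∈ nhds p)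
    (hfb : ∀ θ ∈ H, ‖f θ‖ ≤ exp (-(δ * ∑ j, (θ j - p j) ^ 2))) {u : Fin r → ℝ} {l : ℂ}
    (hl : Tendsto (fun n : ℕ => f (p + (√n)⁻¹ • u) ^ n) atTop (nhds l)) :
    ‖l‖ ≤ exp (-(δ * ∑ j, u j ^ 2)) := by
  refine le_of_tendsto hl.norm ?_
  filter_upwards [eventually_ge_atTop 1, (tendsto_add_inv_sqrt_smul p u).eventually hp]
    with n hn hu
  exact norm_pow_le_of_gaussian hfb hn hu

lemma tendsto_integral_laplace {ψ : (Fin r → ℝ) → ℂ} {L : (Fin r → ℝ) → ℂ}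
    (hH : MeasurableSet H) (hp : H ∈ nhds p) (hf : Continuous f) (hψ : Continuous ψ)
    (hψ1 : ∀ θ, ‖ψ θ‖ ≤ 1) (hδ : 0 < δ)
    (hfb : ∀ θ ∈ H, ‖f θ‖ ≤ exp (-(δ * ∑ j, (θ j - p j) ^ 2)))
    (hL : ∀ u, Tendsto (fun n : ℕ => f (p + (√n)⁻¹ • u) ^ n) atTop (nhds (L u))) :
    Tendsto (fun n : ℕ => ((√n : ℝ) : ℂ) ^ r * ∫ θ in H, f θ ^ n * ψ θ) atTop
      (nhds ((∫ u, L u) * ψ p)) := by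
  have hscale : ∀ n : ℕ, 1 ≤ n → ∫ u, H.indicator (fun θ => f θ ^ n * ψ θ) (p + (√n)⁻¹ • u) =
      ((√n : ℝ) : ℂ) ^ r * ∫ θ in H, f θ ^ n * ψ θ := fun n hn => by
    have hn0 : (0 : ℝ) < √n := sqrt_pos.2 (by exact_mod_cast hn)
    rw [MeasureTheory.Measure.integral_comp_smul MeasureTheory.volume
        (fun θ => H.indicator (fun θ => f θ ^ n * ψ θ) (p + θ)) (√n)⁻¹,
      MeasureTheory.integral_add_left_eq_self, MeasureTheory.integral_indicator hH]
    rw [Module.finrank_fin_fun, inv_pow, inv_inv, abs_of_pos (pow_pos hn0 r), Complex.real_smul]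
    push_cast; rfl
  have hint : MeasureTheory.Integrable fun u : Fin r → ℝ => exp (-(δ * ∑ j, u j ^ 2)) := by
    have := (GaussianFourier.integrable_cexp_neg_mul_sum_add (ι := Fin r) (b := (δ : ℂ))
      (by simpa using hδ) 0).norm
    refine this.congr (.of_forall fun u => ?_)
    have : -(δ : ℂ) * ∑ i, (u i : ℂ) ^ 2 + ∑ i, (0 : Fin r → ℂ) i * u i =
        ((-(δ * ∑ j, u j ^ 2) : ℝ) : ℂ) := by push_cast; simp
    simp only [this, ← Complex.ofReal_exp, Complex.norm_real, norm_eq_abs, abs_exp]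
  have hdct : Tendsto (fun n : ℕ => ∫ u, H.indicator (fun θ => f θ ^ n * ψ θ) (p + (√n)⁻¹ • u))
      atTop (nhds (∫ u, L u * ψ p)) := by
    refine MeasureTheory.tendsto_integral_filter_of_dominated_convergence _ ?_ ?_ hint ?_
    · refine .of_forall fun n => ?_
      have h1 : Measurable (H.indicator fun θ => f θ ^ n * ψ θ) :=
        ((hf.pow n).mul hψ).measurable.indicator hH
      exact (h1.comp (by fun_prop)).aestronglyMeasurable
    · filter_upwards [eventually_ge_atTop 1] with n hn
      refine .of_forall fun u => ?_
      by_cases hu : p + (√n)⁻¹ • u ∈ H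
      · rw [Set.indicator_of_mem hu, norm_mul]
        exact (mul_le_of_le_one_right (norm_nonneg _) (hψ1 _)).trans
          (norm_pow_le_of_gaussian hfb hn hu)
      · rw [Set.indicator_of_notMem hu, norm_zero]
        exact (exp_pos _).le
    · refine .of_forall fun u => ?_
      have h1 := (hL u).mul ((hψ.tendsto p).comp (tendsto_add_inv_sqrt_smul p u))
      refine h1.congr' ?_
      filter_upwards [(tendsto_add_inv_sqrt_smul p u).eventually hp] with n hn
      rw [Set.indicator_of_mem hn]; rfl
  rw [← MeasureTheory.integral_mul_const]
  refine hdct.congr' ?_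
  filter_upwards [eventually_ge_atTop 1] with n hn using hscale n hn

end laplace

lemma cpow_half_two_pi_div_polar {ρ α : ℝ} (hρ : 0 < ρ) (hα : α ∈ Set.Ioo (-π) π) :
    (2 * π / (ρ * Complex.exp (α * Complex.I)) : ℂ) ^ (1 / 2 : ℂ) =
      (√(2 * π / ρ) : ℝ) * Complex.exp ((-(α / 2) : ℝ) * Complex.I) := by
  have h0 : 0 < 2 * π / ρ := by positivity
  have h1 : (2 * π / (ρ * Complex.exp (α * Complex.I)) : ℂ) =
      Complex.exp ((log (2 * π / ρ) : ℝ) + (-α : ℝ) * Complex.I) := by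
    rw [Complex.exp_add, ← Complex.ofReal_exp, exp_log h0]
    push_cast
    rw [neg_mul, Complex.exp_neg, ← div_div, div_eq_mul_inv (2 * π / ρ : ℂ)]
  rw [Complex.cpow_def_of_ne_zero (by rw [h1]; exact Complex.exp_ne_zero _), h1,
    Complex.log_exp (by simpa using hα.2) (by simpa using neg_le.1 hα.1.le), add_mul,
    Complex.exp_add]
  congr 1
  · rw [sqrt_eq_rpow, rpow_def_of_pos h0]; push_cast; rfl
  · congr 1; push_cast; ring

lemma arg_eq_arctan_of_re_pos {z : ℂ} (hz : 0 < z.re) : z.arg = arctan (z.im / z.re) := by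
  have h := abs_lt.1 (Complex.abs_arg_lt_pi_div_two_iff.2 (Or.inl hz))
  rw [← Complex.tan_arg, arctan_tan h.1 h.2]

lemma nat_mul_sin_mul_cos_le_s4 {φ : ℝ} {r : ℕ} (hφ1 : 0 < φ) (hφ2 : r * φ < π) (k : ℕ) (hk : k ≤ r) :
    k * (sin φ * cos (r * φ)) ≤ sin (k * φ) := by
  rcases Nat.eq_zero_or_pos r with rfl | hr
  · simp [Nat.le_zero.1 hk]
  have hr1 : (1 : ℝ) ≤ r := by exact_mod_cast hr
  have hs : 0 < sin φ := sin_pos_of_pos_of_lt_pi hφ1 (by nlinarith)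
  induction k using Nat.twoStepInduction with
  | zero => simp
  | one => simpa using mul_le_of_le_one_right hs.le (cos_le_one _)
  | more k ih _ =>
    have h1 : cos (r * φ) ≤ cos ((k + 1 : ℕ) * φ) := by
      have : ((k + 1 : ℕ) : ℝ) ≤ r := by exact_mod_cast (by lia : k + 1 ≤ r)
      exact cos_le_cos_of_nonneg_of_le_pi (by positivity) hφ2.le (by gcongr)
    have h2 : sin ((k + 2 : ℕ) * φ) = sin (k * φ) + 2 * cos ((k + 1 : ℕ) * φ) * sin φ := by
      have e1 : ((k + 2 : ℕ) : ℝ) * φ = (k + 1 : ℕ) * φ + φ := by push_cast; ring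
      have e2 : (k : ℝ) * φ = (k + 1 : ℕ) * φ - φ := by push_cast; ring
      rw [e1, e2, sin_add, sin_sub]; ring
    have h3 := ih (by lia)
    have h4 := mul_le_mul_of_nonneg_left h1 hs.le
    rw [h2]
    push_cast at h4 ⊢
    linarith

section gaussian

variable {r : ℕ} {φ A : ℝ}

lemma re_pos_of_saddle {w : ℂ} {δ : ℝ} (j₀ : Fin r) (hδ : 0 < δ)
    (h : ∀ u : Fin r → ℝ, ‖Complex.exp (-(w * ∑ j, (u j : ℂ) ^ 2 +
      (w - w ^ 2) * (∑ j, (u j : ℂ)) ^ 2) / 2)‖ ≤ exp (-(δ * ∑ j, u j ^ 2))) :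
    0 < (w + r * (w - w ^ 2)).re := by
  have hr : (0 : ℝ) < r := by exact_mod_cast j₀.pos
  have h1 := h fun _ => 1
  rw [Complex.norm_exp, exp_le_exp] at h1
  have e : -(w * ∑ _j : Fin r, ((1 : ℝ) : ℂ) ^ 2 +
      (w - w ^ 2) * (∑ _j : Fin r, ((1 : ℝ) : ℂ)) ^ 2) / 2 =
      ((-r / 2 : ℝ) : ℂ) * (w + r * (w - w ^ 2)) := by
    simp; ring
  rw [e, Complex.re_ofReal_mul] at h1
  simp only [one_pow, Finset.sum_const, Finset.card_univ, Fintype.card_fin, nsmul_eq_mul,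
    mul_one] at h1
  have : 0 < δ * r := mul_pos hδ hr
  nlinarith

lemma saddle_gaussian_value (j₀ : Fin r) (hφ1 : 0 < φ) (hφ2 : φ < π / 2) (hA : 0 < A) {w q : ℂ}
    (hw : w = A * Complex.exp (φ * Complex.I)) (hwq : w + r * (w - w ^ 2) = w * q)
    (hq : 0 < q.re) (hpos : 0 < (w + r * (w - w ^ 2)).re) :
    ∫ u : Fin r → ℝ, Complex.exp (-(w * ∑ j, (u j : ℂ) ^ 2 +
        (w - w ^ 2) * (∑ j, (u j : ℂ)) ^ 2) / 2) =
      ((√(2 * π / A) ^ r * (√‖q‖)⁻¹ : ℝ) : ℂ) *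
        Complex.exp ((-(r * φ + q.arg) / 2 : ℝ) * Complex.I) := by
  have hwre : 0 < w.re := by
    rw [hw, Complex.re_ofReal_mul, Complex.exp_ofReal_mul_I_re]
    exact mul_pos hA (cos_pos_of_mem_Ioo ⟨by linarith, hφ2⟩)
  have hq0 : 0 < ‖q‖ := norm_pos_iff.2 fun h => by simp [h] at hq
  have harg := abs_lt.1 (Complex.abs_arg_lt_pi_div_two_iff.2 (Or.inl hq))
  have hwq' : w * q = ((A * ‖q‖ : ℝ) : ℂ) * Complex.exp ((φ + q.arg : ℝ) * Complex.I) := by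
    conv_lhs => rw [hw, ← Complex.norm_mul_exp_arg_mul_I q]
    push_cast
    rw [add_mul, Complex.exp_add]; ring
  rw [integral_gaussian_sum_sq j₀ hwre hpos, hwq, hwq', hw,
    cpow_half_two_pi_div_polar hA ⟨by linarith, by linarith⟩,
    cpow_half_two_pi_div_polar (mul_pos hA hq0) ⟨by linarith, by linarith⟩]
  obtain ⟨k, rfl⟩ : ∃ k, r = k + 1 := ⟨r - 1, by have := j₀.pos; lia⟩
  rw [Nat.add_sub_cancel, ← div_div, sqrt_div' _ hq0.le, mul_pow, ← Complex.exp_nat_mul,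
    div_eq_mul_inv (√(2 * π / A))]
  have e : ((-((k + 1 : ℕ) * φ + q.arg) / 2 : ℝ) : ℂ) * Complex.I =
      k * ((-(φ / 2) : ℝ) * Complex.I) + (-((φ + q.arg) / 2) : ℝ) * Complex.I := by
    push_cast; ring
  rw [e, Complex.exp_add]
  push_cast
  ring

end gaussian

lemma saddle_quotient_re_pos {r : ℕ} (hr : 1 ≤ r) {φ : ℝ} (hφ1 : 0 < φ)
    (hφ2 : ((r + 1 : ℕ) : ℝ) * φ < π) :
    0 < 1 - r * (sin φ / sin (r * φ)) * cos ((r + 1 : ℕ) * φ) := by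
  have hr' : (1 : ℝ) ≤ r := by exact_mod_cast hr
  have hrφ : r * φ < π := by push_cast at hφ2; linarith
  have hs0 : 0 < sin (r * φ) := sin_nat_mul_pos hφ1 hr hrφ
  have hs : 0 < sin φ := sin_pos_of_pos_of_lt_pi hφ1 (by nlinarith)
  have h1 := nat_mul_sin_mul_cos_le_s4 hφ1 hrφ r le_rfl
  have h2 : cos ((r + 1 : ℕ) * φ) < cos (r * φ) :=
    cos_lt_cos_of_nonneg_of_le_pi (by positivity) hφ2.le (by push_cast; linarith)
  have h3 : r * (sin φ * cos ((r + 1 : ℕ) * φ)) < sin (r * φ) :=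
    (by gcongr : _ < r * (sin φ * cos (r * φ))).trans_le h1
  rw [sub_pos, mul_div_assoc', div_mul_eq_mul_div, div_lt_one hs0, mul_assoc]
  exact h3

lemma tendsto_half_box_integral {r : ℕ} (j₀ : Fin r) {φ : ℝ} (hφ1 : 0 < φ)
    (hφ2 : ((r + 1 : ℕ) : ℝ) * φ < π) {A c : ℝ}
    (hA : A = sin ((r + 1 : ℕ) * φ) / sin (r * φ)) (hc : c = sin ((r + 1 : ℕ) * φ) / sin φ)
    {ψ : (Fin r → ℝ) → ℂ} (hψ : Continuous ψ) (hψ1 : ∀ θ, ‖ψ θ‖ ≤ 1) {q : ℂ}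
    (hq : q = 1 - r * ((sin φ / sin (r * φ) : ℝ) *
      Complex.exp (((r + 1 : ℕ) * φ : ℝ) * Complex.I))) :
    Tendsto (fun n : ℕ => ((√n : ℝ) : ℂ) ^ r *
        ∫ θ in (Set.univ.pi fun _ : Fin r => Set.Icc (-π) π) ∩ {θ | 0 < θ j₀},
          (phase A c θ / phase A c fun _ : Fin r => φ) ^ n * ψ θ) atTop
      (nhds (((√(2 * π / A) ^ r * (√‖q‖)⁻¹ : ℝ) : ℂ) *
        Complex.exp ((-(r * φ + q.arg) / 2 : ℝ) * Complex.I) * ψ fun _ => φ)) := by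
  have hr : 1 ≤ r := j₀.pos
  have hr' : (1 : ℝ) ≤ r := by exact_mod_cast hr
  have hφ3 : φ < π / 2 := by push_cast at hφ2; nlinarith
  have hs : 0 < sin φ := sin_pos_of_pos_of_lt_pi hφ1 (by linarith)
  have hs0 : 0 < sin (r * φ) := sin_nat_mul_pos hφ1 hr (by push_cast at hφ2; linarith)
  have hs1 : 0 < sin ((r + 1 : ℕ) * φ) := sin_nat_mul_pos hφ1 (by lia) hφ2
  have hA0 : 0 < A := hA ▸ div_pos hs1 hs0
  obtain ⟨δ, hδ, hbound⟩ := exists_norm_phase_le_gaussian j₀ hφ1 hφ2 hA hc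
  set p : Fin r → ℝ := fun _ => φ with hp
  set H := (Set.univ.pi fun _ : Fin r => Set.Icc (-π) π) ∩ {θ | 0 < θ j₀} with hH
  obtain ⟨w, hw⟩ : ∃ w : ℂ, w = A * Complex.exp (φ * Complex.I) := ⟨_, rfl⟩
  have hHm : MeasurableSet H := (isCompact_box r).isClosed.measurableSet.inter
    (isOpen_lt continuous_const (continuous_apply j₀)).measurableSet
  have hHp : H ∈ nhds p := by
    refine inter_mem (set_pi_mem_nhds Set.finite_univ fun i _ => ?_)
      ((isOpen_lt continuous_const (continuous_apply j₀)).mem_nhds hφ1)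
    exact Icc_mem_nhds (by linarith) (by linarith)
  have hM : ‖phase A c p‖ = exp (r * A * cos φ) * (sin (r * φ) / sin φ) := by
    rw [phase_saddle hs.ne' hs0.ne' hA hc, norm_mul, Complex.norm_exp_ofReal_mul_I, mul_one,
      Complex.norm_real, norm_eq_abs, neg_div, mul_neg, abs_neg, abs_of_pos]
    positivity
  have hM0 : 0 < ‖phase A c p‖ := by rw [hM]; positivity
  have hfb : ∀ θ ∈ H, ‖phase A c θ / phase A c p‖ ≤ exp (-(δ * ∑ j, (θ j - p j) ^ 2)) := by
    intro θ hθ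
    rw [norm_div, div_le_iff₀' hM0, hM]
    exact hbound θ (fun j => hθ.1 j (Set.mem_univ j)) (le_of_lt hθ.2)
  have hL : ∀ u : Fin r → ℝ, Tendsto
      (fun n : ℕ => (phase A c (p + (√n)⁻¹ • u) / phase A c p) ^ n) atTop
      (nhds (Complex.exp
        (-(w * ∑ j, (u j : ℂ) ^ 2 + (w - w ^ 2) * (∑ j, (u j : ℂ)) ^ 2) / 2))) := fun u =>
    tendsto_phase_scaled hs.ne' hs0.ne' hA hc hw u
  have hcont : Continuous fun θ : Fin r → ℝ => phase A c θ / phase A c p := by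
    unfold phase; fun_prop
  have hpos := re_pos_of_saddle j₀ hδ fun u => norm_limit_le_of_gaussian hHp hfb (hL u)
  have hwq : w + r * (w - w ^ 2) = w * q := by
    have := saddle_sub_one hs0.ne' hA
    rw [hq, ← this, ← hw]; ring
  have hqre : 0 < q.re := by
    have := saddle_quotient_re_pos hr hφ1 hφ2
    rw [hq, Complex.sub_re, ← Complex.ofReal_natCast, Complex.re_ofReal_mul,
      Complex.re_ofReal_mul, Complex.exp_ofReal_mul_I_re, Complex.one_re, ← mul_assoc]
    exact this
  rw [← saddle_gaussian_value j₀ hφ1 hφ3 hA0 hw hwq hqre hpos]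
  exact tendsto_integral_laplace hHm hHp hcont hψ hψ1 hδ hfb hL

lemma sum_eq_re_half_box_integral {r : ℕ} (j₀ : Fin r) (ν : Fin r → ℕ) {A c M α φ : ℝ}
    (hA : 0 < A) (hM : M ≠ 0)
    (hΦ : phase A c (fun _ : Fin r => φ) = (M : ℂ) * Complex.exp (α * Complex.I))
    {n : ℕ} (hn : 1 ≤ n) :
    (n * A) ^ (∑ j, ν j) * (2 * π) ^ r * √n ^ r * ∑ k ∈ Finset.range (n + 1),
        (n.choose k : ℝ) * (-(n ^ r * (c * A ^ r))) ^ k / ∏ j, ((k + ν j).factorial : ℝ) =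
      2 * M ^ n * (Complex.exp ((n * α : ℝ) * Complex.I) * (((√n : ℝ) : ℂ) ^ r *
        ∫ θ in (Set.univ.pi fun _ : Fin r => Set.Icc (-π) π) ∩ {θ | 0 < θ j₀},
          (phase A c θ / phase A c fun _ : Fin r => φ) ^ n *
            Complex.exp (-(∑ j, (ν j : ℂ) * θ j) * Complex.I))).re := by
  have hn0 : (0 : ℝ) < n := by exact_mod_cast hn
  have hR : 0 < n * A := mul_pos hn0 hA
  have hΦ0 : phase A c (fun _ : Fin r => φ) ≠ 0 := by
    rw [hΦ]; exact mul_ne_zero (by exact_mod_cast hM) (Complex.exp_ne_zero _)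
  have h1 := sum_eq_integral ν hR (n ^ r * (c * A ^ r)) n
  have hint : ∀ θ : Fin r → ℝ, Complex.exp (((n * A : ℝ) : ℂ) *
        ∑ j, Complex.exp (θ j * Complex.I)) *
      (1 - ((n ^ r * (c * A ^ r) : ℝ) : ℂ) / ((n * A : ℝ) : ℂ) ^ r *
        Complex.exp (-(∑ j, (θ j : ℂ)) * Complex.I)) ^ n *
      Complex.exp (-(∑ j, (ν j : ℂ) * θ j) * Complex.I) =
      phase A c θ ^ n * Complex.exp (-(∑ j, (ν j : ℂ) * θ j) * Complex.I) := fun θ => by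
    have e1 : ((n ^ r * (c * A ^ r) : ℝ) : ℂ) / ((n * A : ℝ) : ℂ) ^ r = c := by
      rw [← Complex.ofReal_pow, ← Complex.ofReal_div]
      congr 1
      rw [mul_pow]
      field_simp
    rw [e1, phase, mul_pow, ← Complex.exp_nat_mul]
    push_cast
    simp only [mul_assoc]
  simp_rw [hint] at h1
  rw [integral_box_eq_two_re j₀ (by unfold phase; fun_prop) (fun θ => ?_)] at h1
  · simp only [div_pow, div_mul_eq_mul_div]
    rw [MeasureTheory.integral_div]
    set J := ∫ θ in (Set.univ.pi fun _ : Fin r => Set.Icc (-π) π) ∩ {θ | 0 < θ j₀},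
      phase A c θ ^ n * Complex.exp (-(∑ j, (ν j : ℂ) * θ j) * Complex.I)
    have hM' : (M : ℂ) ^ n ≠ 0 := pow_ne_zero _ (by exact_mod_cast hM)
    have e2 : Complex.exp ((n * α : ℝ) * Complex.I) * (((√n : ℝ) : ℂ) ^ r *
        (J / phase A c (fun _ : Fin r => φ) ^ n)) = ((√n ^ r / M ^ n : ℝ) : ℂ) * J := by
      have := Complex.exp_ne_zero ((n * α : ℝ) * Complex.I)
      rw [hΦ, mul_pow, ← Complex.exp_nat_mul,
        show (n : ℂ) * (α * Complex.I) = (n * α : ℝ) * Complex.I by push_cast; ring]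
      push_cast at this ⊢
      field_simp
    rw [e2, Complex.re_ofReal_mul]
    have h2 : (n * A) ^ (∑ j, ν j) * (2 * π) ^ r * ∑ k ∈ Finset.range (n + 1),
        (n.choose k : ℝ) * (-(n ^ r * (c * A ^ r))) ^ k / ∏ j, ((k + ν j).factorial : ℝ) =
        2 * J.re := by
      apply Complex.ofReal_injective
      rw [← h1]
      push_cast
      rfl
    rw [mul_right_comm, h2]
    have : M ^ n ≠ 0 := pow_ne_zero _ hM
    field_simp
  · simp only [phase, map_mul, map_pow, map_sub, map_one, ← Complex.exp_conj, map_sum, map_neg,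
      Complex.conj_ofReal, Complex.conj_I, map_natCast, Pi.neg_apply, Complex.ofReal_neg, neg_mul,
      mul_neg, neg_neg, Finset.sum_neg_distrib]

lemma rpow_neg_quarter_normSq (z : ℂ) :
    (z.re ^ 2 + z.im ^ 2) ^ (-(1 : ℝ) / 4) = (√‖z‖)⁻¹ := by
  have h : z.re ^ 2 + z.im ^ 2 = ‖z‖ ^ 2 := by rw [Complex.sq_norm, Complex.normSq_apply]; ring
  rw [h, ← rpow_natCast, ← rpow_mul (norm_nonneg _), sqrt_eq_rpow, ← rpow_neg (norm_nonneg _)]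
  norm_num

lemma tendsto_sub_cos_of_tendsto {K : ℕ → ℂ} {N g α : ℝ} (hN : N ≠ 0)
    (hK : Tendsto K atTop (nhds (N * Complex.exp (g * Complex.I)))) :
    Tendsto (fun n : ℕ => (Complex.exp ((n * α : ℝ) * Complex.I) * K n).re / N -
      cos (n * α + g)) atTop (nhds 0) := by
  refine squeeze_zero_norm (a := fun n => ‖K n - N * Complex.exp (g * Complex.I)‖ / |N|)
    (fun n => ?_) ?_
  · have e : (Complex.exp ((n * α : ℝ) * Complex.I) * K n).re / N - cos (n * α + g) =
        (Complex.exp ((n * α : ℝ) * Complex.I) * (K n - N * Complex.exp (g * Complex.I))).re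
          / N := by
      have e1 : Complex.exp ((n * α : ℝ) * Complex.I) * (N * Complex.exp (g * Complex.I)) =
          N * Complex.exp ((n * α + g : ℝ) * Complex.I) := by
        rw [mul_left_comm, ← Complex.exp_add]; push_cast; ring_nf
      rw [mul_sub, e1, Complex.sub_re, Complex.re_ofReal_mul, Complex.exp_ofReal_mul_I_re]
      field_simp
    rw [e, norm_eq_abs, abs_div]
    gcongr
    refine (Complex.abs_re_le_norm _).trans_eq ?_
    rw [norm_mul, Complex.norm_exp_ofReal_mul_I, one_mul]
  · simpa using (tendsto_iff_norm_sub_tendsto_zero.1 hK).div_const |N|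

/-- Plancherel–Rotach asymptotics for `F_n(n^r ρ(φ))` on the oscillatory region. -/
theorem stmt_4 (r : ℕ) (hr : 1 ≤ r) (ν : Fin r → ℕ)
    (F : ℕ → ℝ → ℝ)
    (hF : ∀ n x, F n x = ∑ k ∈ Finset.range (n + 1),
      (n.choose k : ℝ) * (-x) ^ k / ∏ j, ((k + ν j).factorial : ℝ))
    (φ : ℝ) (hφ1 : 0 < φ) (hφ2 : φ < π / ((r : ℝ) + 1))
    (ρ A s D g : ℝ)
    (hρ : ρ = Real.sin (((r : ℝ) + 1) * φ) ^ (r + 1) /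
      (Real.sin φ * Real.sin ((r : ℝ) * φ) ^ r))
    (hA : A = Real.sin (((r : ℝ) + 1) * φ) / Real.sin ((r : ℝ) * φ))
    (hs : s = ∑ j, (ν j : ℝ))
    (hD : D = ((1 - (r : ℝ) * Real.sin φ * Real.cos (((r : ℝ) + 1) * φ) /
          Real.sin ((r : ℝ) * φ)) ^ 2 +
        ((r : ℝ) * Real.sin φ * Real.sin (((r : ℝ) + 1) * φ) /
          Real.sin ((r : ℝ) * φ)) ^ 2) ^ (-(1 : ℝ) / 4))
    (hg : g = -((r : ℝ) / 2 + s) * φ -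
      (1 / 2) * Real.arctan (-((r : ℝ) * Real.sin φ * Real.sin (((r : ℝ) + 1) * φ)) /
        (Real.sin ((r : ℝ) * φ) - (r : ℝ) * Real.sin φ * Real.cos (((r : ℝ) + 1) * φ)))) :
    Tendsto (fun n : ℕ =>
      F n ((n : ℝ) ^ r * ρ) /
        ((2 / (2 * π) ^ ((r : ℝ) / 2)) *
          (Real.sin ((r : ℝ) * φ) / ((n : ℝ) * Real.sin (((r : ℝ) + 1) * φ))) ^ ((r : ℝ) / 2 + s) *
          Real.exp ((n : ℝ) * (r : ℝ) * A * Real.cos φ) *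
          (-Real.sin ((r : ℝ) * φ) / Real.sin φ) ^ n * D)
      - Real.cos ((n : ℝ) * ((r : ℝ) * A * Real.sin φ - ((r : ℝ) + 1) * φ) + g))
      atTop (nhds 0) := by
  have hcast : (r : ℝ) + 1 = ((r + 1 : ℕ) : ℝ) := by push_cast; rfl
  rw [hcast] at hφ2 hρ hA hD hg ⊢
  rw [lt_div_iff₀' (by positivity)] at hφ2
  have hs' : 0 < sin φ := by
    have hr' : (1 : ℝ) ≤ r := by exact_mod_cast hr
    exact sin_pos_of_pos_of_lt_pi hφ1 (by push_cast at hφ2; nlinarith)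
  have hs0 : 0 < sin (r * φ) := sin_nat_mul_pos hφ1 hr (by push_cast at hφ2; linarith)
  have hs1 : 0 < sin ((r + 1 : ℕ) * φ) := sin_nat_mul_pos hφ1 (by lia) hφ2
  have hA0 : 0 < A := hA ▸ div_pos hs1 hs0
  obtain ⟨c, hc⟩ : ∃ c, c = sin ((r + 1 : ℕ) * φ) / sin φ := ⟨_, rfl⟩
  obtain ⟨q, hq⟩ : ∃ q : ℂ, q = 1 - r * ((sin φ / sin (r * φ) : ℝ) *
      Complex.exp (((r + 1 : ℕ) * φ : ℝ) * Complex.I)) := ⟨_, rfl⟩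
  have hqre : q.re = 1 - r * sin φ * cos ((r + 1 : ℕ) * φ) / sin (r * φ) := by
    rw [hq, Complex.sub_re, ← Complex.ofReal_natCast r, Complex.re_ofReal_mul,
      Complex.re_ofReal_mul, Complex.exp_ofReal_mul_I_re, Complex.one_re]
    ring
  have hqim : q.im = -(r * sin φ * sin ((r + 1 : ℕ) * φ) / sin (r * φ)) := by
    rw [hq, Complex.sub_im, ← Complex.ofReal_natCast r, Complex.im_ofReal_mul,
      Complex.im_ofReal_mul, Complex.exp_ofReal_mul_I_im, Complex.one_im]
    ring
  have hq0 : 0 < q.re := by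
    rw [hqre]
    convert! saddle_quotient_re_pos hr hφ1 hφ2 using 1
    ring
  have hqn : 0 < ‖q‖ := norm_pos_iff.2 fun h => by simp [h] at hq0
  have hD' : D = (√‖q‖)⁻¹ := by
    rw [hD, ← rpow_neg_quarter_normSq, hqre, hqim, neg_sq]
  have hg' : g = -(r * φ + q.arg) / 2 - s * φ := by
    have : q.im / q.re = -(r * sin φ * sin ((r + 1 : ℕ) * φ)) /
        (sin (r * φ) - r * sin φ * cos ((r + 1 : ℕ) * φ)) := by
      rw [hqim, hqre]
      field_simp
    rw [hg, ← this, ← arg_eq_arctan_of_re_pos hq0]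
    ring
  have hρ' : ρ = c * A ^ r := by
    rw [hρ, hc, hA, div_pow, pow_succ]
    field_simp
  obtain ⟨α, hα⟩ : ∃ α, α = r * A * sin φ - (r + 1 : ℕ) * φ := ⟨_, rfl⟩
  obtain ⟨M, hM⟩ : ∃ M, M = exp (r * A * cos φ) * (-sin (r * φ) / sin φ) := ⟨_, rfl⟩
  have hM0 : M ≠ 0 := hM ▸ mul_ne_zero (exp_ne_zero _)
    (div_ne_zero (neg_ne_zero.2 hs0.ne') hs'.ne')
  have hΦ : phase A c (fun _ : Fin r => φ) = (M : ℂ) * Complex.exp (α * Complex.I) := by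
    rw [phase_saddle hs'.ne' hs0.ne' hA hc, hM, hα, hcast]
  obtain ⟨N, hN⟩ : ∃ N, N = √(2 * π / A) ^ r * (√‖q‖)⁻¹ := ⟨_, rfl⟩
  have hN0 : 0 < N := by rw [hN]; positivity
  let j₀ : Fin r := ⟨0, hr⟩
  have hK := tendsto_half_box_integral j₀ hφ1 hφ2 hA hc
    (ψ := fun θ => Complex.exp (-(∑ j, (ν j : ℂ) * θ j) * Complex.I)) (by fun_prop)
    (fun θ => by
      rw [show -(∑ j, (ν j : ℂ) * θ j) = ((-∑ j, (ν j : ℝ) * θ j : ℝ) : ℂ) by push_cast; rfl,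
        Complex.norm_exp_ofReal_mul_I]) hq
  have hlim : Complex.exp ((-(r * φ + q.arg) / 2 : ℝ) * Complex.I) *
      Complex.exp (-(∑ j, (ν j : ℂ) * φ) * Complex.I) = Complex.exp (g * Complex.I) := by
    rw [← Complex.exp_add, hg', hs, ← Finset.sum_mul]
    push_cast
    ring_nf
  rw [mul_assoc, hlim, ← hN] at hK
  refine (tendsto_sub_cos_of_tendsto (α := α) hN0.ne' hK).congr' ?_
  filter_upwards [eventually_ge_atTop 1] with n hn
  have hn0 : (0 : ℝ) < n := by exact_mod_cast hn
  have hsum := sum_eq_re_half_box_integral j₀ ν hA0 hM0 hΦ hn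
  rw [← hρ', ← hF] at hsum
  rw [← hα]
  congr 1
  set T := (Complex.exp ((n * α : ℝ) * Complex.I) * _ : ℂ).re
  set W : ℝ := (n * A) ^ (∑ j, ν j) * (2 * π) ^ r * √n ^ r with hW
  have hW0 : 0 < W := by positivity
  have hden : 2 / (2 * π) ^ ((r : ℝ) / 2) *
      (sin (r * φ) / (n * sin ((r + 1 : ℕ) * φ))) ^ ((r : ℝ) / 2 + s) *
      exp (n * r * A * cos φ) * (-sin (r * φ) / sin φ) ^ n * D = 2 * M ^ n * N / W := by
    have e1 : sin (r * φ) / (n * sin ((r + 1 : ℕ) * φ)) = (n * A)⁻¹ := by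
      rw [hA]; field_simp
    have e2 : exp (n * r * A * cos φ) = exp (r * A * cos φ) ^ n := by
      rw [← exp_nat_mul]; ring_nf
    have e3 : s = ((∑ j, ν j : ℕ) : ℝ) := by rw [hs]; push_cast; rfl
    have e4 : (2 * π) ^ r = √(2 * π) ^ r * √(2 * π) ^ r := by
      rw [← mul_pow, mul_self_sqrt (by positivity)]
    rw [e1, e2, rpow_add (by positivity), rpow_div_two_eq_sqrt _ (by positivity),
      rpow_div_two_eq_sqrt _ (by positivity), e3, rpow_natCast, rpow_natCast, rpow_natCast, hM,
      hN, hW, hD', e4, sqrt_div' _ hA0.le, sqrt_inv, sqrt_mul hn0.le]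
    simp only [mul_pow, div_pow, inv_pow]
    field_simp
  rw [hden, div_div_eq_mul_div, mul_comm (F n _), hsum]
  have : M ^ n ≠ 0 := pow_ne_zero _ hM0
  field_simp
end

section
/- Fix φ ∈ (0, π/2). Then, as n → ∞, L_n^{(0)}(4n cos²φ) divided by ( (−1)^n exp(2n cos²φ) (π n sin(2φ))^{−1/2} ) minus cos( n(sin(2φ) − 2φ) − φ + π/4 ) tends to 0. -/
open Real Filter

/-- Laplace's method for `∫ F ^ n` with complex-valued `F` whose modulus peaks at `θ₀`. -/
theorem tendsto_sqrt_mul_integral_pow {F : ℝ → ℂ} (hF : Continuous F) {α β θ₀ c : ℝ} {b : ℂ}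
    (hα : α < θ₀) (hβ : θ₀ < β) (hc : 0 < c) (hb : 0 < b.re)
    (hbd : ∀ θ ∈ Set.Icc α β, ‖F θ‖ ≤ Real.exp (-c * (θ - θ₀) ^ 2))
    (hT : (fun θ : ℝ => F θ - (1 - b * (θ - θ₀) ^ 2)) =o[nhds θ₀] fun θ : ℝ => (θ - θ₀) ^ 2) :
    Tendsto (fun n : ℕ => ((√(n : ℝ) : ℝ) : ℂ) * ∫ θ in α..β, F θ ^ n) atTop
      (nhds ((π / b) ^ (1 / 2 : ℂ))) := by
  have hsq : Tendsto (fun n : ℕ => √(n : ℝ)) atTop atTop :=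
    tendsto_sqrt_atTop.comp tendsto_natCast_atTop_atTop
  have hαβ : α ≤ β := (hα.trans hβ).le
  let J : ℕ → Set ℝ := fun n => Set.Ioc (√(n : ℝ) * (α - θ₀)) (√(n : ℝ) * (β - θ₀))
  let H : ℕ → ℝ → ℂ := fun n => (J n).indicator fun s => F (s / √(n : ℝ) + θ₀) ^ n
  have hH : Tendsto (fun n => ∫ s, H n s) atTop (nhds (∫ s : ℝ, Complex.exp (-b * (s : ℂ) ^ 2))) := by
    refine MeasureTheory.tendsto_integral_of_dominated_convergence
      (fun s => Real.exp (-c * s ^ 2)) (fun n => ?_) (integrable_exp_neg_mul_sq hc)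
      (fun n => .of_forall fun s => ?_) (.of_forall fun s => ?_)
    · exact (Continuous.aestronglyMeasurable (by fun_prop)).indicator measurableSet_Ioc
    · by_cases hs : s ∈ J n
      · simp only [H, Set.indicator_of_mem hs]
        have hn : n ≠ 0 := by
          rintro rfl
          simp [J] at hs
        have hr : 0 < √(n : ℝ) := Real.sqrt_pos.2 (by positivity)
        have hmem : s / √(n : ℝ) + θ₀ ∈ Set.Icc α β := by
          have h1 : α - θ₀ ≤ s / √(n : ℝ) := by
            rw [le_div_iff₀ hr, mul_comm]; exact hs.1.le
          have h2 : s / √(n : ℝ) ≤ β - θ₀ := by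
            rw [div_le_iff₀ hr, mul_comm]; exact hs.2
          constructor <;> linarith
        rw [norm_pow]
        refine (pow_le_pow_left₀ (norm_nonneg _) (hbd _ hmem) n).trans (le_of_eq ?_)
        rw [← Real.exp_nat_mul, add_sub_cancel_right, div_pow, Real.sq_sqrt (by positivity)]
        congr 1
        field_simp
      · simp only [H, Set.indicator_of_notMem hs, norm_zero]
        positivity
    · have hu : Tendsto (fun n : ℕ => s / √(n : ℝ) + θ₀) atTop (nhds θ₀) := by
        simpa using (hsq.const_div_atTop s).add_const θ₀
      have hlim : Tendsto (fun n : ℕ => F (s / √(n : ℝ) + θ₀) ^ n) atTop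
          (nhds (Complex.exp (-b * (s : ℂ) ^ 2))) := by
        apply Complex.tendsto_pow_exp_of_isLittleO_sub_add_div
        have h := hT.comp_tendsto hu
        have h2 : ((fun θ : ℝ => (θ - θ₀) ^ 2) ∘ fun n : ℕ => s / √(n : ℝ) + θ₀)
            =O[atTop] fun n : ℕ => 1 / (n : ℂ) := by
          refine Asymptotics.IsBigO.of_bound (s ^ 2) (.of_forall fun n => ?_)
          simp only [Function.comp, add_sub_cancel_right, div_pow, norm_div, norm_pow,
            Real.norm_eq_abs, sq_abs, Real.sq_sqrt (Nat.cast_nonneg n), norm_one,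
            Complex.norm_natCast, mul_one_div, Nat.abs_cast, le_refl]
        refine (h.trans_isBigO h2).congr_left fun n => ?_
        have h3 : ((√(n : ℝ) : ℝ) : ℂ) ^ 2 = n := by
          rw [← Complex.ofReal_pow, Real.sq_sqrt (by positivity)]; simp
        simp only [Function.comp, Complex.ofReal_add, Complex.ofReal_div, add_sub_cancel_right,
          div_pow, h3]
        ring
      refine hlim.congr' ?_
      have e1 : ∀ᶠ n : ℕ in atTop, √(n : ℝ) * (α - θ₀) < s :=
        (hsq.atTop_mul_const_of_neg (sub_neg.2 hα)).eventually_lt_atBot s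
      have e2 : ∀ᶠ n : ℕ in atTop, s ≤ √(n : ℝ) * (β - θ₀) :=
        (hsq.atTop_mul_const (sub_pos.2 hβ)).eventually_ge_atTop s
      filter_upwards [e1, e2] with n h1 h2
      exact (Set.indicator_of_mem (show s ∈ J n from ⟨h1, h2⟩)
        fun s => F (s / √(n : ℝ) + θ₀) ^ n).symm
  rw [integral_gaussian_complex hb] at hH
  refine hH.congr' ?_
  filter_upwards [eventually_gt_atTop 0] with n hn
  have hr : 0 < √(n : ℝ) := Real.sqrt_pos.2 (by positivity)
  have h := intervalIntegral.integral_comp_div_add (a := √(n : ℝ) * (α - θ₀))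
    (b := √(n : ℝ) * (β - θ₀)) (fun θ => F θ ^ n) hr.ne' θ₀
  rw [mul_div_cancel_left₀ _ hr.ne', mul_div_cancel_left₀ _ hr.ne', sub_add_cancel,
    sub_add_cancel] at h
  rw [← Complex.real_smul, ← h, MeasureTheory.integral_indicator measurableSet_Ioc,
    intervalIntegral.integral_of_le (by gcongr)]

/-- A generating function whose `n`-th power has mean `L_n(n a²)` over the circle. -/
noncomputable def laguerreKernel (a θ : ℝ) : ℂ :=
  (1 + a * Complex.exp (-(θ * Complex.I))) * Complex.exp (-a * Complex.exp (θ * Complex.I))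

theorem contDiff_laguerreKernel (a : ℝ) {m : WithTop ℕ∞} : ContDiff ℝ m (laguerreKernel a) := by
  have h : ContDiff ℝ m fun θ : ℝ => (θ : ℂ) := Complex.ofRealCLM.contDiff
  unfold laguerreKernel
  fun_prop

theorem integral_exp_mul_exp_pow (c : ℂ) (k : ℕ) :
    ∫ θ in (0 : ℝ)..2 * π, Complex.exp (-(θ * Complex.I)) ^ k *
      Complex.exp (c * Complex.exp (θ * Complex.I)) = 2 * π * (c ^ k / k.factorial) := by
  have h := DiffContOnCl.circleIntegral_one_div_sub_center_pow_smul (R := 1) (c := 0) one_pos k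
    (f := fun z : ℂ => Complex.exp (c * z)) (Differentiable.diffContOnCl (by fun_prop))
  rw [iteratedDeriv_cexp_const_mul] at h
  have h2 : (∮ z in C(0, 1), (1 / (z - 0) ^ (k + 1)) • Complex.exp (c * z)) = Complex.I *
      ∫ θ in (0 : ℝ)..2 * π, Complex.exp (-(θ * Complex.I)) ^ k *
        Complex.exp (c * Complex.exp (θ * Complex.I)) := by
    rw [circleIntegral, ← intervalIntegral.integral_const_mul]
    refine intervalIntegral.integral_congr fun θ _ => ?_
    simp only [deriv_circleMap, circleMap, sub_zero, zero_add, Complex.ofReal_one, one_mul,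
      smul_eq_mul, Complex.exp_neg, inv_pow, one_div]
    have := Complex.exp_ne_zero (θ * Complex.I)
    field_simp
    ring
  rw [h2] at h
  simp only [mul_zero, Complex.exp_zero, mul_one, smul_eq_mul] at h
  apply mul_left_cancel₀ Complex.I_ne_zero
  rw [h]
  ring

theorem integral_laguerreKernel_pow (a : ℝ) (n : ℕ) :
    ∫ θ in (0 : ℝ)..2 * π, laguerreKernel a θ ^ n =
      2 * π * ((∑ k ∈ Finset.range (n + 1),
        (n.choose k : ℝ) * (-(n * a ^ 2)) ^ k / (k.factorial : ℝ) : ℝ) : ℂ) := by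
  have h : ∀ θ : ℝ, laguerreKernel a θ ^ n = ∑ k ∈ Finset.range (n + 1),
      ((n.choose k : ℂ) * a ^ k) * (Complex.exp (-(θ * Complex.I)) ^ k *
        Complex.exp ((-(n * a) : ℂ) * Complex.exp (θ * Complex.I))) := by
    intro θ
    rw [laguerreKernel, mul_pow, ← Complex.exp_nat_mul, add_comm, add_pow, Finset.sum_mul]
    refine Finset.sum_congr rfl fun k _ => ?_
    rw [show (n : ℂ) * (-a * Complex.exp (θ * Complex.I)) =
      (-(n * a) : ℂ) * Complex.exp (θ * Complex.I) by ring]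
    simp only [mul_pow, one_pow]
    ring
  simp_rw [h]
  rw [intervalIntegral.integral_finsetSum fun k _ => Continuous.intervalIntegrable (by fun_prop) _ _]
  simp_rw [intervalIntegral.integral_const_mul, integral_exp_mul_exp_pow]
  push_cast
  rw [Finset.mul_sum]
  refine Finset.sum_congr rfl fun k _ => ?_
  rw [show (-(n * (a : ℂ) ^ 2)) = a * -(n * a) by ring, mul_pow (a : ℂ)]
  ring

theorem laguerreKernel_two_pi_sub (a θ : ℝ) :
    laguerreKernel a (2 * π - θ) = (starRingEnd ℂ) (laguerreKernel a θ) := by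
  have h : Complex.exp (((2 * π - θ : ℝ) : ℂ) * Complex.I) = Complex.exp (-(θ * Complex.I)) := by
    rw [show ((2 * π - θ : ℝ) : ℂ) * Complex.I = -(θ * Complex.I) + 2 * π * Complex.I by
      push_cast; ring, Complex.exp_add, Complex.exp_two_pi_mul_I, mul_one]
  simp only [laguerreKernel, h, Complex.exp_neg, map_mul, map_add, map_one, Complex.conj_ofReal,
    ← Complex.exp_conj, map_neg, Complex.conj_I, mul_neg, inv_inv, map_inv₀]

theorem sum_eq_re_integral_laguerreKernel_pow (a : ℝ) (n : ℕ) :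
    ∑ k ∈ Finset.range (n + 1), (n.choose k : ℝ) * (-(n * a ^ 2)) ^ k / (k.factorial : ℝ) =
      (∫ θ in (0 : ℝ)..π, laguerreKernel a θ ^ n).re / π := by
  have hc : Continuous fun θ => laguerreKernel a θ ^ n :=
    ((contDiff_laguerreKernel a (m := 0)).continuous).pow n
  have h := integral_laguerreKernel_pow a n
  rw [← intervalIntegral.integral_add_adjacent_intervals (b := π) (hc.intervalIntegrable _ _)
    (hc.intervalIntegrable _ _)] at h
  have h2 := intervalIntegral.integral_comp_sub_left (a := 0) (b := π)
    (fun θ => laguerreKernel a θ ^ n) (2 * π)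
  rw [sub_zero, show 2 * π - π = π by ring] at h2
  simp_rw [laguerreKernel_two_pi_sub, ← map_pow] at h2
  rw [intervalIntegral.intervalIntegral_conj] at h2
  rw [← h2, Complex.add_conj] at h
  have h3 : 2 * (∫ θ in (0 : ℝ)..π, laguerreKernel a θ ^ n).re = 2 * π *
      ∑ k ∈ Finset.range (n + 1), (n.choose k : ℝ) * (-(n * a ^ 2)) ^ k / (k.factorial : ℝ) := by
    exact_mod_cast h
  rw [eq_div_iff pi_ne_zero]
  linarith

theorem one_add_mul_exp_neg_le {t : ℝ} (h1 : -1 ≤ t) (h2 : t ≤ 8) :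
    (1 + t) * Real.exp (-t) ≤ Real.exp (-(Real.exp (-8) / 4) * t ^ 2) := by
  have e1 : 1 + t + t ^ 2 / 4 ≤ Real.exp t := by
    have h3 : (t / 3 + 1) ^ 3 ≤ Real.exp (t / 3) ^ 3 :=
      pow_le_pow_left₀ (by linarith) (Real.add_one_le_exp _) 3
    rw [← Real.exp_nat_mul, show ((3 : ℕ) : ℝ) * (t / 3) = t by push_cast; ring] at h3
    nlinarith [mul_nonneg (sq_nonneg t) (by linarith : 0 ≤ t + 1)]
  have e2 : Real.exp (-8) ≤ Real.exp (-t) := Real.exp_le_exp.2 (by linarith)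
  have e3 := Real.add_one_le_exp (-(Real.exp (-8) / 4) * t ^ 2)
  have e4 : Real.exp t * Real.exp (-t) = 1 := by rw [← Real.exp_add]; simp
  have e5 := mul_le_mul_of_nonneg_right e1 (Real.exp_pos (-t)).le
  have e6 := mul_le_mul_of_nonneg_right e2 (sq_nonneg t)
  nlinarith

theorem norm_laguerreKernel_sq (a θ : ℝ) :
    ‖laguerreKernel a θ‖ ^ 2 =
      (1 + a ^ 2 + 2 * a * Real.cos θ) * Real.exp (-(2 * a * Real.cos θ)) := by
  rw [laguerreKernel, norm_mul, mul_pow, Complex.norm_exp, ← Real.exp_nat_mul,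
    ← Complex.normSq_eq_norm_sq]
  congr 1
  · rw [← neg_mul, ← Complex.ofReal_neg, Complex.exp_mul_I, ← Complex.ofReal_cos,
      ← Complex.ofReal_sin, Complex.normSq_apply]
    simp [-Complex.ofReal_cos, -Complex.ofReal_sin]
    nlinarith [Real.sin_sq_add_cos_sq θ]
  · congr 1
    simp [Complex.exp_ofReal_mul_I_re]
    ring

theorem mul_abs_sub_le_abs_cos_sub_cos {θ φ : ℝ} (hφ1 : 0 < φ) (hφ2 : φ < π / 2)
    (hθ : θ ∈ Set.Icc 0 π) :
    2 / π * Real.sin (φ / 2) * |θ - (π - φ)| ≤ |Real.cos θ - Real.cos (π - φ)| := by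
  obtain ⟨h0, h1⟩ := hθ
  have hs : 0 < Real.sin (φ / 2) := Real.sin_pos_of_pos_of_lt_pi (by linarith) (by linarith)
  have e1 : Real.sin (φ / 2) ≤ |Real.sin ((θ + (π - φ)) / 2)| := by
    refine le_trans ?_ (le_abs_self _)
    rw [← Real.cos_pi_div_two_sub, ← Real.cos_pi_div_two_sub,
      ← Real.cos_abs (π / 2 - (θ + (π - φ)) / 2)]
    refine Real.cos_le_cos_of_nonneg_of_le_pi (abs_nonneg _) (by linarith) ?_
    rw [abs_le]
    constructor <;> linarith
  have e2 := Real.mul_abs_le_abs_sin (x := (θ - (π - φ)) / 2)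
    (by rw [abs_le]; constructor <;> linarith)
  rw [abs_div, abs_two] at e2
  rw [Real.cos_sub_cos, abs_mul, abs_mul, abs_neg, abs_two]
  have e3 := mul_le_mul e1 e2 (by positivity) (abs_nonneg _)
  calc _ = 2 * (Real.sin (φ / 2) * (2 / π * (|θ - (π - φ)| / 2))) := by ring
    _ ≤ _ := by rw [mul_assoc]; gcongr

theorem exists_norm_laguerreKernel_le {φ : ℝ} (hφ1 : 0 < φ) (hφ2 : φ < π / 2) :
    ∃ c > 0, ∀ θ ∈ Set.Icc 0 π, ‖laguerreKernel (2 * Real.cos φ) θ‖ ≤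
      Real.exp (2 * Real.cos φ ^ 2) * Real.exp (-c * (θ - (π - φ)) ^ 2) := by
  have hcos : 0 < Real.cos φ := Real.cos_pos_of_mem_Ioo ⟨by linarith, hφ2⟩
  have hs : 0 < Real.sin (φ / 2) := Real.sin_pos_of_pos_of_lt_pi (by linarith) (by linarith)
  set d := 4 * Real.cos φ * (2 / π * Real.sin (φ / 2)) with hd
  have hdpos : 0 < d := by positivity
  refine ⟨Real.exp (-8) / 8 * d ^ 2, by positivity, fun θ hθ => ?_⟩
  refine le_of_sq_le_sq ?_ (by positivity)
  set t := 4 * Real.cos φ * (Real.cos θ + Real.cos φ) with ht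
  have ht1 : -1 ≤ t := by
    nlinarith [Real.sin_sq_add_cos_sq θ, sq_nonneg (2 * Real.cos φ + Real.cos θ),
      sq_nonneg (Real.sin θ)]
  have ht2 : t ≤ 8 := by
    nlinarith [Real.cos_le_one φ, mul_le_mul_of_nonneg_left
      (add_le_add (Real.cos_le_one θ) (Real.cos_le_one φ)) hcos.le]
  have hdt : d * |θ - (π - φ)| ≤ |t| := by
    have h := mul_abs_sub_le_abs_cos_sub_cos hφ1 hφ2 hθ
    rw [Real.cos_pi_sub, sub_neg_eq_add] at h
    rw [ht, abs_mul, abs_of_pos (by positivity : 0 < 4 * Real.cos φ), hd, mul_assoc]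
    gcongr
  have hdt2 : d ^ 2 * (θ - (π - φ)) ^ 2 ≤ t ^ 2 := by
    rw [← sq_abs (θ - _), ← sq_abs t, ← mul_pow]
    gcongr
  rw [norm_laguerreKernel_sq, mul_pow (Real.exp _), ← Real.exp_nat_mul, ← Real.exp_nat_mul]
  calc _ = Real.exp (4 * Real.cos φ ^ 2) * ((1 + t) * Real.exp (-t)) := by
        rw [mul_left_comm (Real.exp _) (1 + t), ← Real.exp_add]
        rw [ht]
        ring_nf
    _ ≤ Real.exp (4 * Real.cos φ ^ 2) * Real.exp (-(Real.exp (-8) / 4) * t ^ 2) := by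
        gcongr
        exact one_add_mul_exp_neg_le ht1 ht2
    _ ≤ _ := by
        gcongr ?_ * ?_
        · refine (Real.exp_le_exp.2 ?_)
          push_cast; linarith
        · refine (Real.exp_le_exp.2 ?_)
          push_cast
          nlinarith [mul_le_mul_of_nonneg_left hdt2 (Real.exp_pos (-8)).le]

theorem deriv_laguerreKernel (a : ℝ) :
    deriv (laguerreKernel a) = fun θ : ℝ => -Complex.I * a * (2 * Complex.cos θ + a) *
      Complex.exp (-a * Complex.exp (θ * Complex.I)) := by
  ext θ
  have h0 : HasDerivAt (fun θ : ℝ => (θ : ℂ) * Complex.I) Complex.I θ := by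
    simpa using (Complex.ofRealCLM.hasDerivAt (x := θ)).mul_const Complex.I
  have h := ((h0.neg.cexp.const_mul (a : ℂ)).const_add 1).mul (h0.cexp.const_mul (-a : ℂ)).cexp
  refine (h.congr_deriv ?_).deriv
  have e : Complex.exp (-(θ * Complex.I)) * Complex.exp (θ * Complex.I) = 1 := by
    rw [← Complex.exp_add]; simp
  rw [Complex.two_cos, neg_mul (θ : ℂ)]
  linear_combination (-Complex.I * a ^ 2 *
    Complex.exp (-a * Complex.exp (θ * Complex.I))) * e

theorem exp_pi_sub_mul_I (φ : ℝ) :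
    Complex.exp (((π - φ : ℝ) : ℂ) * Complex.I) = -Complex.exp (-(φ * Complex.I)) := by
  rw [Complex.ofReal_sub, sub_mul, sub_eq_add_neg, Complex.exp_add, Complex.exp_pi_mul_I,
    neg_one_mul]

theorem deriv_deriv_laguerreKernel (φ : ℝ) :
    deriv (deriv (laguerreKernel (2 * Real.cos φ))) (π - φ) =
      4 * Complex.I * Real.cos φ * Real.sin φ *
        Complex.exp (2 * Real.cos φ * Complex.exp (-(φ * Complex.I))) := by
  rw [deriv_laguerreKernel]
  have h0 : HasDerivAt (fun θ : ℝ => (θ : ℂ)) 1 (π - φ) := Complex.ofRealCLM.hasDerivAt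
  have h1 := (((Complex.hasDerivAt_cos ((π - φ : ℝ) : ℂ)).comp_ofReal.const_mul 2).add_const
    ((2 * Real.cos φ : ℝ) : ℂ)).const_mul
    (-Complex.I * ((2 * Real.cos φ : ℝ) : ℂ))
  have h := h1.mul (((h0.mul_const Complex.I).cexp.const_mul (-(2 * Real.cos φ : ℝ) : ℂ)).cexp)
  refine (h.congr_deriv ?_).deriv
  have hc : Complex.cos ((π - φ : ℝ) : ℂ) = -Real.cos φ := by
    rw [← Complex.ofReal_cos, Real.cos_pi_sub, Complex.ofReal_neg]
  have hs : Complex.sin ((π - φ : ℝ) : ℂ) = Real.sin φ := by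
    rw [← Complex.ofReal_sin, Real.sin_pi_sub]
  rw [hc, hs, exp_pi_sub_mul_I]
  push_cast
  ring_nf

theorem laguerreKernel_pi_sub (φ : ℝ) : laguerreKernel (2 * Real.cos φ) (π - φ) =
    -Complex.exp (2 * φ * Complex.I) *
        Complex.exp (2 * Real.cos φ * Complex.exp (-(φ * Complex.I))) := by
  rw [laguerreKernel, Complex.exp_neg, exp_pi_sub_mul_I]
  have e1 : Complex.exp (2 * φ * Complex.I) = Complex.exp (φ * Complex.I) ^ 2 := by
    rw [← Complex.exp_nat_mul]; push_cast; ring_nf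
  have e2 := Complex.exp_ne_zero (φ * Complex.I)
  rw [inv_neg, ← Complex.exp_neg, neg_neg, e1]
  congr 1
  · rw [Complex.ofReal_mul, Complex.ofReal_cos, Complex.ofReal_ofNat, Complex.two_cos,
      neg_mul (φ : ℂ), Complex.exp_neg]
    field_simp
    ring
  · push_cast
    ring_nf

theorem laguerreKernel_pi_sub_eq (φ : ℝ) : laguerreKernel (2 * Real.cos φ) (π - φ) =
    -Real.exp (2 * Real.cos φ ^ 2) *
      Complex.exp (((2 * φ - Real.sin (2 * φ) : ℝ) : ℂ) * Complex.I) := by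
  rw [laguerreKernel_pi_sub, neg_mul, neg_mul, ← Complex.exp_add, Complex.ofReal_exp,
    ← Complex.exp_add, ← neg_mul, Complex.exp_mul_I, Real.sin_two_mul, Complex.cos_neg,
    Complex.sin_neg]
  push_cast
  ring_nf

theorem isLittleO_laguerreKernel (φ : ℝ) :
    (fun θ : ℝ => laguerreKernel (2 * Real.cos φ) θ / laguerreKernel (2 * Real.cos φ) (π - φ) -
      (1 - Complex.I * Real.sin (2 * φ) * Complex.exp (-(2 * φ * Complex.I)) *
        (θ - (π - φ : ℝ)) ^ 2)) =o[nhds (π - φ)] fun θ : ℝ => (θ - (π - φ)) ^ 2 := by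
  set K := laguerreKernel (2 * Real.cos φ)
  have hK : K (π - φ) ≠ 0 := by
    simp [K, laguerreKernel_pi_sub, Complex.exp_ne_zero]
  have h := taylor_isLittleO_univ (n := 2) (x₀ := π - φ)
    (contDiff_laguerreKernel (2 * Real.cos φ))
  have hd : deriv K (π - φ) = 0 := by
    rw [deriv_laguerreKernel]
    dsimp only
    rw [← Complex.ofReal_cos, Real.cos_pi_sub]
    push_cast
    ring
  have hd2 : deriv (deriv K) (π - φ) = -2 * Complex.I * Real.sin (2 * φ) *
      Complex.exp (-(2 * φ * Complex.I)) * K (π - φ) := by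
    rw [deriv_deriv_laguerreKernel, show K (π - φ) = _ from laguerreKernel_pi_sub φ,
      Real.sin_two_mul]
    have he : Complex.exp (-(2 * φ * Complex.I)) * Complex.exp (2 * φ * Complex.I) = 1 := by
      rw [← Complex.exp_add]; simp
    push_cast
    linear_combination (-4 * Complex.I * Complex.cos φ * Complex.sin φ *
      Complex.exp (2 * Complex.cos φ * Complex.exp (-(φ * Complex.I)))) * he
  refine (h.const_mul_left (K (π - φ))⁻¹).congr_left fun θ => ?_
  simp only [taylorWithinEval_succ, taylor_within_zero_eval, iteratedDerivWithin_univ,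
    iteratedDeriv_succ, iteratedDeriv_zero, Complex.real_smul]
  change (K (π - φ))⁻¹ * (K θ - (K (π - φ) + _ * deriv K (π - φ) +
    _ * deriv (deriv K) (π - φ))) = _
  rw [hd, hd2]
  push_cast
  simp
  field_simp
  ring

theorem sqrt_mul_pi_div_cpow {φ : ℝ} (hφ1 : 0 < φ) (hφ2 : φ < π / 2) :
    (√(Real.sin (2 * φ) / π) : ℂ) *
      (π / (Complex.I * Real.sin (2 * φ) * Complex.exp (-(2 * φ * Complex.I)))) ^ (1 / 2 : ℂ) =
      Complex.exp (((φ - π / 4 : ℝ) : ℂ) * Complex.I) := by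
  have hs : 0 < Real.sin (2 * φ) := Real.sin_pos_of_pos_of_lt_pi (by linarith) (by linarith)
  have h1 : (π / (Complex.I * Real.sin (2 * φ) * Complex.exp (-(2 * φ * Complex.I))) : ℂ) =
      ((√(π / Real.sin (2 * φ)) : ℝ) * Complex.exp (((φ - π / 4 : ℝ) : ℂ) * Complex.I)) ^ 2 := by
    rw [mul_pow, ← Complex.ofReal_pow, Real.sq_sqrt (by positivity), ← Complex.exp_nat_mul,
      show ((2 : ℕ) : ℂ) * (((φ - π / 4 : ℝ) : ℂ) * Complex.I) =
        2 * φ * Complex.I + -(π / 2 * Complex.I) by push_cast; ring,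
      Complex.exp_add, Complex.exp_neg, Complex.exp_neg, Complex.exp_pi_div_two_mul_I,
      Complex.inv_I]
    have hs' : (Real.sin (2 * φ) : ℂ) ≠ 0 := Complex.ofReal_ne_zero.2 hs.ne'
    have he := Complex.exp_ne_zero (2 * φ * Complex.I)
    rw [Complex.ofReal_div]
    field_simp
    simp
  have hre : 0 < (((√(π / Real.sin (2 * φ)) : ℝ) : ℂ) *
      Complex.exp (((φ - π / 4 : ℝ) : ℂ) * Complex.I)).re := by
    rw [Complex.re_ofReal_mul, Complex.exp_ofReal_mul_I_re]
    exact mul_pos (Real.sqrt_pos.2 (by positivity))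
      (Real.cos_pos_of_mem_Ioo ⟨by linarith, by linarith⟩)
  rw [h1, one_div, Complex.sq_cpow_two_inv hre, ← mul_assoc, ← Complex.ofReal_mul,
    ← Real.sqrt_mul (by positivity), div_mul_div_cancel₀ pi_ne_zero, div_self hs.ne']
  simp

theorem tendsto_integral_laguerreKernel_pow {φ : ℝ} (hφ1 : 0 < φ) (hφ2 : φ < π / 2) :
    Tendsto (fun n : ℕ => ((√(n : ℝ) : ℝ) : ℂ) * ∫ θ in (0 : ℝ)..π,
      (laguerreKernel (2 * Real.cos φ) θ / laguerreKernel (2 * Real.cos φ) (π - φ)) ^ n) atTop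
      (nhds ((π / (Complex.I * Real.sin (2 * φ) *
        Complex.exp (-(2 * φ * Complex.I)))) ^ (1 / 2 : ℂ))) := by
  obtain ⟨c, hc, hbd⟩ := exists_norm_laguerreKernel_le hφ1 hφ2
  have hs : 0 < Real.sin (2 * φ) := Real.sin_pos_of_pos_of_lt_pi (by linarith) (by linarith)
  refine tendsto_sqrt_mul_integral_pow (θ₀ := π - φ)
    ((contDiff_laguerreKernel _ (m := 0)).continuous.div_const _)
    (by linarith) (by linarith) hc ?_ (fun θ hθ => ?_) (isLittleO_laguerreKernel φ)
  · have h : (Complex.I * Real.sin (2 * φ) * Complex.exp (-(2 * φ * Complex.I))).re =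
        Real.sin (2 * φ) ^ 2 := by
      rw [show -(2 * φ * Complex.I) = ((-(2 * φ) : ℝ) : ℂ) * Complex.I by push_cast; ring,
        mul_comm Complex.I, mul_assoc, Complex.re_ofReal_mul, Complex.I_mul_re,
        Complex.exp_ofReal_mul_I_im, Real.sin_neg]
      ring
    rw [h]
    positivity
  · rw [norm_div, div_le_iff₀' (by simp [laguerreKernel_pi_sub, Complex.exp_ne_zero])]
    refine (hbd θ hθ).trans_eq ?_
    rw [laguerreKernel_pi_sub_eq, norm_mul, Complex.norm_exp_ofReal_mul_I, norm_neg,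
      Complex.norm_real, Real.norm_of_nonneg (Real.exp_pos _).le, mul_one]

/-- Plancherel–Rotach type asymptotics for the classical Laguerre polynomials
`L_n^{(0)}` at `x = 4n cos²φ`. -/
theorem stmt_5 (L : ℕ → ℝ → ℝ)
    (hL : ∀ n x, L n x = ∑ k ∈ Finset.range (n + 1),
      (n.choose k : ℝ) * (-x) ^ k / (k.factorial : ℝ))
    (φ : ℝ) (hφ1 : 0 < φ) (hφ2 : φ < π / 2) :
    Tendsto (fun n : ℕ =>
      L n (4 * (n : ℝ) * Real.cos φ ^ 2) /
        ((-1 : ℝ) ^ n * Real.exp (2 * (n : ℝ) * Real.cos φ ^ 2) *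
          (π * (n : ℝ) * Real.sin (2 * φ)) ^ (-(1 : ℝ) / 2))
      - Real.cos ((n : ℝ) * (Real.sin (2 * φ) - 2 * φ) - φ + π / 4))
      atTop (nhds 0) := by
  have hs : 0 < Real.sin (2 * φ) := Real.sin_pos_of_pos_of_lt_pi (by linarith) (by linarith)
  have hlim := (tendsto_integral_laguerreKernel_pow hφ1 hφ2).const_mul
    (√(Real.sin (2 * φ) / π) : ℂ)
  rw [sqrt_mul_pi_div_cpow hφ1 hφ2] at hlim
  refine squeeze_zero_norm' ?_ (tendsto_iff_norm_sub_tendsto_zero.1 hlim)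
  filter_upwards [eventually_gt_atTop 0] with n hn
  set K₀ := laguerreKernel (2 * Real.cos φ) (π - φ) with hK₀
  have hne : K₀ ≠ 0 := by simp [K₀, laguerreKernel_pi_sub, Complex.exp_ne_zero]
  set I := ∫ θ in (0 : ℝ)..π, (laguerreKernel (2 * Real.cos φ) θ / K₀) ^ n with hI
  set u := Complex.exp (((n * (2 * φ - Real.sin (2 * φ)) : ℝ) : ℂ) * Complex.I) with hu
  have hKn : K₀ ^ n = (((-1) ^ n * Real.exp (2 * n * Real.cos φ ^ 2) : ℝ) : ℂ) * u := by
    rw [hK₀, laguerreKernel_pi_sub_eq, mul_pow, neg_pow, hu, ← Complex.exp_nat_mul,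
      ← Complex.ofReal_pow, ← Real.exp_nat_mul]
    push_cast
    ring_nf
  have hL' : L n (4 * (n : ℝ) * Real.cos φ ^ 2) =
      (-1) ^ n * Real.exp (2 * n * Real.cos φ ^ 2) * (u * I).re / π := by
    rw [hL, show 4 * (n : ℝ) * Real.cos φ ^ 2 = n * (2 * Real.cos φ) ^ 2 by ring,
      sum_eq_re_integral_laguerreKernel_pow, ← Complex.re_ofReal_mul, ← mul_assoc, ← hKn, hI,
      ← intervalIntegral.integral_const_mul]
    simp_rw [← mul_pow, mul_div_cancel₀ _ hne]
  have hcos : Real.cos ((n : ℝ) * (Real.sin (2 * φ) - 2 * φ) - φ + π / 4) =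
      (u * Complex.exp (((φ - π / 4 : ℝ) : ℂ) * Complex.I)).re := by
    rw [hu, ← Complex.exp_add, ← add_mul, ← Complex.ofReal_add, Complex.exp_ofReal_mul_I_re,
      ← Real.cos_neg]
    ring_nf
  have hratio : L n (4 * (n : ℝ) * Real.cos φ ^ 2) /
        ((-1 : ℝ) ^ n * Real.exp (2 * (n : ℝ) * Real.cos φ ^ 2) *
          (π * (n : ℝ) * Real.sin (2 * φ)) ^ (-(1 : ℝ) / 2)) =
      (u * ((√(Real.sin (2 * φ) / π) : ℂ) * ((√(n : ℝ) : ℂ) * I))).re := by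
    have hpow : (π * (n : ℝ) * Real.sin (2 * φ)) ^ (-(1 : ℝ) / 2) =
        (π * (√(Real.sin (2 * φ) / π) * √(n : ℝ)))⁻¹ := by
      rw [neg_div, Real.rpow_neg (by positivity), ← Real.sqrt_eq_rpow,
        ← Real.sqrt_mul (by positivity)]
      congr 1
      rw [Real.sqrt_eq_iff_mul_self_eq (by positivity) (by positivity), ← sq, mul_pow,
        Real.sq_sqrt (by positivity)]
      field_simp
    rw [hL', hpow, show u * ((√(Real.sin (2 * φ) / π) : ℂ) * ((√(n : ℝ) : ℂ) * I)) =
      ((√(Real.sin (2 * φ) / π) * √(n : ℝ) : ℝ) : ℂ) * (u * I) by push_cast; ring,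
      Complex.re_ofReal_mul]
    have := pi_ne_zero
    have h1 : ((-1 : ℝ) ^ n) ≠ 0 := by simp
    field_simp
  rw [hratio, hcos, ← Complex.sub_re, ← mul_sub, Real.norm_eq_abs]
  refine (Complex.abs_re_le_norm _).trans_eq ?_
  rw [norm_mul, hu, Complex.norm_exp_ofReal_mul_I, one_mul]
end

section
/- The function ρ(φ) = (sin((r+1)φ))^{r+1} / (sin φ · (sin(rφ))^r) is a strictly decreasing bijection from the interval (0, π/(r+1)) onto the interval (0, (r+1)^{r+1}/r^r). -/
open Real

open Set Filter Topology

theorem sin_mul_pos_of_mem_Ioo {a b x : ℝ} (ha : 0 < a) (hab : a ≤ b)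
    (hx : x ∈ Ioo 0 (π / b)) : 0 < sin (a * x) := by
  have hb : 0 < b := ha.trans_le hab
  have hbx : x * b < π := (lt_div_iff₀ hb).1 hx.2
  refine sin_pos_of_pos_of_lt_pi (mul_pos ha hx.1) ?_
  nlinarith [hx.1]

theorem mul_cos_mul_sin_sub_neg {a b x : ℝ} (ha : 0 < a) (hab : a < b)
    (hx : x ∈ Ioo 0 (π / b)) :
    b * cos (b * x) * sin (a * x) - sin (b * x) * (a * cos (a * x)) < 0 := by
  have hderiv : ∀ y, HasDerivAt
      (fun y ↦ b * cos (b * y) * sin (a * y) - sin (b * y) * (a * cos (a * y)))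
      (-((b ^ 2 - a ^ 2) * (sin (b * y) * sin (a * y)))) y := by
    intro y
    have hmul (c : ℝ) : HasDerivAt (fun y ↦ c * y) c y := by
      simpa using (hasDerivAt_id y).const_mul c
    exact ((((hmul b).cos.const_mul b).mul (hmul a).sin).sub
      ((hmul b).sin.mul ((hmul a).cos.const_mul a))).congr_deriv (by ring)
  have hanti : StrictAntiOn
      (fun y ↦ b * cos (b * y) * sin (a * y) - sin (b * y) * (a * cos (a * y)))
      (Ico 0 (π / b)) := by
    refine strictAntiOn_of_deriv_neg (convex_Ico _ _)
      (fun y _ ↦ (hderiv y).continuousAt.continuousWithinAt) fun y hy ↦ ?_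
    rw [interior_Ico] at hy
    rw [(hderiv y).deriv, neg_lt_zero]
    have hsq : 0 < b ^ 2 - a ^ 2 := by nlinarith
    exact mul_pos hsq (mul_pos (sin_mul_pos_of_mem_Ioo (ha.trans hab) le_rfl hy)
      (sin_mul_pos_of_mem_Ioo ha hab.le hy))
  simpa using hanti (left_mem_Ico.2 (hx.1.trans hx.2)) ⟨hx.1.le, hx.2⟩ hx.1

theorem strictAntiOn_sin_mul_div_sin_mul {a b : ℝ} (ha : 0 < a) (hab : a < b) :
    StrictAntiOn (fun x ↦ sin (b * x) / sin (a * x)) (Ioo 0 (π / b)) := by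
  have hderiv : ∀ y ∈ Ioo 0 (π / b), HasDerivAt (fun x ↦ sin (b * x) / sin (a * x))
      ((b * cos (b * y) * sin (a * y) - sin (b * y) * (a * cos (a * y))) / sin (a * y) ^ 2)
      y := by
    intro y hy
    have hmul (c : ℝ) : HasDerivAt (fun y ↦ c * y) c y := by
      simpa using (hasDerivAt_id y).const_mul c
    exact ((hmul b).sin.div (hmul a).sin
      (sin_mul_pos_of_mem_Ioo ha hab.le hy).ne').congr_deriv (by ring)
  refine strictAntiOn_of_deriv_neg (convex_Ioo _ _)
    (fun y hy ↦ (hderiv y hy).continuousAt.continuousWithinAt) fun y hy ↦ ?_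
  rw [interior_Ioo] at hy
  rw [(hderiv y hy).deriv]
  exact div_neg_of_neg_of_pos (mul_cos_mul_sin_sub_neg ha hab hy)
    (pow_pos (sin_mul_pos_of_mem_Ioo ha hab.le hy) 2)

theorem tendsto_sin_mul_div_sin_mul {a b : ℝ} (ha : a ≠ 0) (hb : b ≠ 0) :
    Tendsto (fun x ↦ sin (b * x) / sin (a * x)) (𝓝[>] 0) (𝓝 (b / a)) := by
  have hsinc (c : ℝ) : Tendsto (fun x ↦ c * sinc (c * x)) (𝓝[>] 0) (𝓝 c) := by
    have h : Continuous fun x ↦ c * sinc (c * x) := by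
      have := continuous_sinc
      fun_prop
    simpa using (h.tendsto 0).mono_left nhdsWithin_le_nhds
  refine ((hsinc b).div (hsinc a) ha).congr' ?_
  filter_upwards [self_mem_nhdsWithin] with x hx
  have hx0 : x ≠ 0 := ne_of_gt hx
  rw [Pi.div_apply, sinc_of_ne_zero (mul_ne_zero hb hx0), sinc_of_ne_zero (mul_ne_zero ha hx0)]
  field_simp

/-- `ρ(φ) = (sin((r+1)φ))^{r+1} / (sin φ (sin(rφ))^r)` is a strictly decreasing
bijection from `(0, π/(r+1))` onto `(0, (r+1)^{r+1}/r^r)`. -/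
theorem stmt_6 (r : ℕ) (hr : 1 ≤ r) (ρ : ℝ → ℝ)
    (hρ : ∀ φ, ρ φ = Real.sin (((r : ℝ) + 1) * φ) ^ (r + 1) /
      (Real.sin φ * Real.sin ((r : ℝ) * φ) ^ r)) :
    StrictAntiOn ρ (Set.Ioo 0 (π / ((r : ℝ) + 1))) ∧
    Set.BijOn ρ (Set.Ioo 0 (π / ((r : ℝ) + 1)))
      (Set.Ioo 0 (((r : ℝ) + 1) ^ (r + 1) / (r : ℝ) ^ r)) := by
  have hr0 : (0 : ℝ) < r := by exact_mod_cast hr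
  have hr1 : (0 : ℝ) < r + 1 := by positivity
  have hI : 0 < π / ((r : ℝ) + 1) := div_pos pi_pos hr1
  have hfac : ρ = fun x ↦ sin (((r : ℝ) + 1) * x) / sin (1 * x) *
      (sin (((r : ℝ) + 1) * x) / sin (r * x)) ^ r := by
    funext x
    rw [hρ, one_mul, div_pow, div_mul_div_comm, pow_succ']
  have hs1 {x : ℝ} (hx : x ∈ Ioo 0 (π / ((r : ℝ) + 1))) : 0 < sin x := by
    simpa using sin_mul_pos_of_mem_Ioo one_pos (by linarith) hx
  have hsr {x : ℝ} (hx : x ∈ Ioo 0 (π / ((r : ℝ) + 1))) : 0 < sin (r * x) :=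
    sin_mul_pos_of_mem_Ioo hr0 (by linarith) hx
  have hsr1 {x : ℝ} (hx : x ∈ Ioo 0 (π / ((r : ℝ) + 1))) : 0 < sin (((r : ℝ) + 1) * x) :=
    sin_mul_pos_of_mem_Ioo hr1 le_rfl hx
  have hanti : StrictAntiOn ρ (Ioo 0 (π / ((r : ℝ) + 1))) := by
    intro x hx y hy hxy
    have h1 := strictAntiOn_sin_mul_div_sin_mul one_pos (by linarith) hx hy hxy
    have h2 := strictAntiOn_sin_mul_div_sin_mul hr0 (by linarith) hx hy hxy
    have hpos := div_pos (hsr1 hy) (hsr hy)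
    rw [hfac]
    refine mul_lt_mul h1 (pow_le_pow_left₀ hpos.le h2.le r) (pow_pos hpos r) ?_
    rw [one_mul]
    exact (div_pos (hsr1 hx) (hs1 hx)).le
  have hzero : Tendsto ρ (𝓝[>] 0) (𝓝 (((r : ℝ) + 1) ^ (r + 1) / (r : ℝ) ^ r)) := by
    have h := (tendsto_sin_mul_div_sin_mul one_ne_zero hr1.ne').mul
      ((tendsto_sin_mul_div_sin_mul hr0.ne' hr1.ne').pow r)
    rw [hfac]
    convert h using 2
    rw [div_one, div_pow, pow_succ', mul_div_assoc]
  have hcont {x : ℝ} (h1 : sin x ≠ 0) (h2 : sin (r * x) ≠ 0) : ContinuousAt ρ x := by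
    rw [funext hρ]
    exact ContinuousAt.div (by fun_prop) (by fun_prop) (mul_ne_zero h1 (pow_ne_zero r h2))
  have hend : Tendsto ρ (𝓝[<] (π / ((r : ℝ) + 1))) (𝓝 0) := by
    have hval : ρ (π / ((r : ℝ) + 1)) = 0 := by
      rw [hρ, mul_div_cancel₀ _ hr1.ne', sin_pi, zero_pow r.succ_ne_zero, zero_div]
    have hlt : r * (π / ((r : ℝ) + 1)) < π := by
      rw [← mul_div_assoc, div_lt_iff₀ hr1]
      nlinarith [pi_pos]
    have h := hcont (x := π / ((r : ℝ) + 1))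
      (sin_pos_of_pos_of_lt_pi hI (div_lt_self pi_pos (by linarith))).ne'
      (sin_pos_of_pos_of_lt_pi (mul_pos hr0 hI) hlt).ne'
    rw [← hval]
    exact h.tendsto.mono_left nhdsWithin_le_nhds
  refine ⟨hanti, fun x hx ↦ ⟨?_, ?_⟩, hanti.injOn, ?_⟩
  · rw [hρ]
    exact div_pos (pow_pos (hsr1 hx) _) (mul_pos (hs1 hx) (pow_pos (hsr hx) r))
  · obtain ⟨y, hy0, hyx⟩ := exists_between hx.1
    have hy : y ∈ Ioo 0 (π / ((r : ℝ) + 1)) := ⟨hy0, hyx.trans hx.2⟩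
    refine (hanti hy hx hyx).trans_le (ge_of_tendsto hzero ?_)
    filter_upwards [Ioo_mem_nhdsGT hy0] with z hz
    exact (hanti ⟨hz.1, hz.2.trans hy.2⟩ hy hz.2).le
  · exact isPreconnected_Ioo.intermediate_value_Ioo
      (le_principal_iff.2 (Ioo_mem_nhdsLT hI)) (le_principal_iff.2 (Ioo_mem_nhdsGT hI))
      (fun x hx ↦ (hcont (hs1 hx).ne' (hsr hx).ne').continuousWithinAt) hend hzero
end

section
/- The function f(φ) = (r+1)φ − r (sin((r+1)φ)/sin(rφ)) sin φ is a strictly increasing bijection from the interval (0, π/(r+1)) onto the interval (0, π). -/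
open Real

lemma sinc_pos_of_nonneg_of_lt_pi {x : ℝ} (h0 : 0 ≤ x) (hx : x < π) : 0 < sinc x := by
  rcases h0.eq_or_lt with rfl | h
  · simp
  · rw [sinc_of_ne_zero h.ne']
    exact div_pos (sin_pos_of_pos_of_lt_pi h hx) h

lemma mul_sin_div_sin_mul_sin_eq_sinc {r : ℝ} (hr : r ≠ 0) (x : ℝ) :
    r * (sin ((r + 1) * x) / sin (r * x)) * sin x =
      sin ((r + 1) * x) * (sinc x / sinc (r * x)) := by
  rcases eq_or_ne x 0 with rfl | hx
  · simp
  · rw [sinc_of_ne_zero hx, sinc_of_ne_zero (mul_ne_zero hr hx)]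
    rcases eq_or_ne (sin (r * x)) 0 with h | h
    · simp [h]
    · field_simp

lemma hasDerivAt_sub_mul_sin_div_sin_mul_sin (r : ℝ) {x : ℝ} (h : sin (r * x) ≠ 0) :
    HasDerivAt (fun x => (r + 1) * x - r * (sin ((r + 1) * x) / sin (r * x)) * sin x)
      (((sin (r * x) - r * sin x * cos ((r + 1) * x)) ^ 2 +
        (r * sin x * sin ((r + 1) * x)) ^ 2) / sin (r * x) ^ 2) x := by
  have hs (c : ℝ) : HasDerivAt (fun x => sin (c * x)) (cos (c * x) * c) x := by
    simpa using ((hasDerivAt_id x).const_mul c).sin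
  have hd := ((hasDerivAt_id x).const_mul (r + 1)).sub
    ((((hs (r + 1)).div (hs r) h).const_mul r).mul (hasDerivAt_sin x))
  refine hd.congr_deriv ?_
  have e : (r + 1) * x = r * x + x := by ring
  simp only [e, sin_add, cos_add, Pi.div_apply]
  field_simp
  have h1 := sin_sq_add_cos_sq x
  have h2 := sin_sq_add_cos_sq (r * x)
  generalize sin (r * x) = S at *
  generalize cos (r * x) = C at *
  generalize sin x = s at *
  generalize cos x = c at *
  have h1 : c ^ 2 = 1 - s ^ 2 := by linarith
  have h2 : C ^ 2 = 1 - S ^ 2 := by linarith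
  grind

/-- `f(φ) = (r+1)φ − r(sin((r+1)φ)/sin(rφ)) sin φ` is a strictly increasing
bijection from `(0, π/(r+1))` onto `(0, π)`. -/
theorem stmt_7 (r : ℕ) (hr : 1 ≤ r) (f : ℝ → ℝ)
    (hf : ∀ φ, f φ = ((r : ℝ) + 1) * φ -
      (r : ℝ) * (Real.sin (((r : ℝ) + 1) * φ) / Real.sin ((r : ℝ) * φ)) * Real.sin φ) :
    StrictMonoOn f (Set.Ioo 0 (π / ((r : ℝ) + 1))) ∧
    Set.BijOn f (Set.Ioo 0 (π / ((r : ℝ) + 1))) (Set.Ioo 0 π) := by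
  have hr0 : (0 : ℝ) < r := by exact_mod_cast hr
  have hb : 0 < π / ((r : ℝ) + 1) := by positivity
  have hlt {x : ℝ} (h0 : 0 ≤ x) (hx : x ≤ π / ((r : ℝ) + 1)) : r * x < π := by
    rw [le_div_iff₀ (by positivity)] at hx
    rcases h0.eq_or_lt with rfl | h0
    · simpa using pi_pos
    · linarith
  have hcont : ContinuousOn f (Set.Icc 0 (π / ((r : ℝ) + 1))) := by
    have hf' : f = fun x => ((r : ℝ) + 1) * x -
        sin (((r : ℝ) + 1) * x) * (sinc x / sinc (r * x)) := by
      funext x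
      rw [hf, mul_sin_div_sin_mul_sin_eq_sinc hr0.ne']
    rw [hf']
    have hsinc : ContinuousOn (fun x => sinc x / sinc (r * x))
        (Set.Icc 0 (π / ((r : ℝ) + 1))) :=
      continuous_sinc.continuousOn.div
        (continuous_sinc.comp (continuous_const_mul (r : ℝ))).continuousOn fun x hx =>
          (sinc_pos_of_nonneg_of_lt_pi (mul_nonneg hr0.le hx.1) (hlt hx.1 hx.2)).ne'
    fun_prop
  have hmono : StrictMonoOn f (Set.Icc 0 (π / ((r : ℝ) + 1))) := by
    refine strictMonoOn_of_deriv_pos (convex_Icc _ _) hcont fun x hx => ?_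
    rw [interior_Icc] at hx
    have hS : 0 < sin (r * x) :=
      sin_pos_of_pos_of_lt_pi (mul_pos hr0 hx.1) (hlt hx.1.le hx.2.le)
    have hx' : ((r : ℝ) + 1) * x < π := by
      have := (lt_div_iff₀ (by positivity)).1 hx.2
      linarith
    have hx0 := hx.1
    have hT : 0 < sin (((r : ℝ) + 1) * x) := sin_pos_of_pos_of_lt_pi (by positivity) hx'
    have hs : 0 < sin x := sin_pos_of_pos_of_lt_pi hx0 (by nlinarith)
    rw [funext hf, (hasDerivAt_sub_mul_sin_div_sin_mul_sin r hS.ne').deriv]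
    positivity
  have hf0 : f 0 = 0 := by simp [hf]
  have hfb : f (π / ((r : ℝ) + 1)) = π := by
    rw [hf, mul_div_cancel₀ π (by positivity : (r : ℝ) + 1 ≠ 0)]
    simp
  refine ⟨hmono.mono Set.Ioo_subset_Icc_self, fun x hx => ?_,
    (hmono.mono Set.Ioo_subset_Icc_self).injOn, ?_⟩
  · have hxI := Set.Ioo_subset_Icc_self hx
    exact ⟨hf0 ▸ hmono (Set.left_mem_Icc.2 hb.le) hxI hx.1,
      (hmono hxI (Set.right_mem_Icc.2 hb.le) hx.2).trans_eq hfb⟩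
  · have := intermediate_value_Ioo hb.le hcont
    rwa [hf0, hfb] at this
end

section
/- For every φ ∈ (0, π/(r+1)): (i) f is differentiable at φ with f'(φ) = ( r² sin²φ + (r+1) sin²(rφ) − r sin(rφ) sin((r+2)φ) ) / sin²(rφ); (ii) ρ is differentiable at φ with ρ'(φ) = −( r² sin²φ − 2r sin φ sin(rφ) cos((r+1)φ) + sin²(rφ) ) · (sin((r+1)φ))^r / ( sin²φ (sin(rφ))^{r+1} ); and (iii) −f'(φ)/(π ρ'(φ)) = (1/(π ρ(φ))) · sin((r+1)φ) sin φ / sin(rφ). -/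
open Real

/-- Derivatives of `f` and `ρ`, and the key identity
`−f'(φ)/(π ρ'(φ)) = (1/(π ρ(φ))) sin((r+1)φ) sin φ / sin(rφ)`. -/
theorem stmt_8 (r : ℕ) (hr : 1 ≤ r) (φ : ℝ) (hφ1 : 0 < φ) (hφ2 : φ < π / ((r : ℝ) + 1))
    (ρ f : ℝ → ℝ)
    (hρ : ∀ t, ρ t = Real.sin (((r : ℝ) + 1) * t) ^ (r + 1) /
      (Real.sin t * Real.sin ((r : ℝ) * t) ^ r))
    (hf : ∀ t, f t = ((r : ℝ) + 1) * t -
      (r : ℝ) * (Real.sin (((r : ℝ) + 1) * t) / Real.sin ((r : ℝ) * t)) * Real.sin t) :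
    HasDerivAt f
      (((r : ℝ) ^ 2 * Real.sin φ ^ 2 + ((r : ℝ) + 1) * Real.sin ((r : ℝ) * φ) ^ 2 -
        (r : ℝ) * Real.sin ((r : ℝ) * φ) * Real.sin (((r : ℝ) + 2) * φ)) /
        Real.sin ((r : ℝ) * φ) ^ 2) φ ∧
    HasDerivAt ρ
      (-(((r : ℝ) ^ 2 * Real.sin φ ^ 2 -
          2 * (r : ℝ) * Real.sin φ * Real.sin ((r : ℝ) * φ) * Real.cos (((r : ℝ) + 1) * φ) +
          Real.sin ((r : ℝ) * φ) ^ 2) *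
        Real.sin (((r : ℝ) + 1) * φ) ^ r /
        (Real.sin φ ^ 2 * Real.sin ((r : ℝ) * φ) ^ (r + 1)))) φ ∧
    -(deriv f φ) / (π * deriv ρ φ) =
      (1 / (π * ρ φ)) * (Real.sin (((r : ℝ) + 1) * φ) * Real.sin φ / Real.sin ((r : ℝ) * φ)) := by
  have hr0 : (0 : ℝ) < r := by exact_mod_cast hr
  have hA_lt : ((r : ℝ) + 1) * φ < π := by
    rw [lt_div_iff₀ (by positivity)] at hφ2
    linarith
  have hs : 0 < sin φ := sin_pos_of_pos_of_lt_pi hφ1 (by nlinarith)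
  have hS : 0 < sin ((r : ℝ) * φ) := sin_pos_of_pos_of_lt_pi (by positivity) (by linarith)
  have hA : 0 < sin (((r : ℝ) + 1) * φ) := sin_pos_of_pos_of_lt_pi (by positivity) hA_lt
  have sin_diff : sin (((r : ℝ) + 1) * φ) * cos ((r : ℝ) * φ) -
      cos (((r : ℝ) + 1) * φ) * sin ((r : ℝ) * φ) = sin φ := by
    rw [← sin_sub]; ring_nf
  have sin_pred : sin (((r : ℝ) + 1) * φ) * cos φ - cos (((r : ℝ) + 1) * φ) * sin φ =
      sin ((r : ℝ) * φ) := by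
    rw [← sin_sub]; ring_nf
  have sin_succ : sin (((r : ℝ) + 2) * φ) =
      sin (((r : ℝ) + 1) * φ) * cos φ + cos (((r : ℝ) + 1) * φ) * sin φ := by
    rw [← sin_add]; ring_nf
  have sin_sq_add := sin_sq_add_cos_sq (((r : ℝ) + 1) * φ)
  have deriv_sin_mul (a : ℝ) : HasDerivAt (fun t => sin (a * t)) (cos (a * φ) * a) φ := by
    simpa using ((hasDerivAt_id φ).const_mul a).sin
  have dA := deriv_sin_mul ((r : ℝ) + 1)
  have dS := deriv_sin_mul r
  have ds := hasDerivAt_sin φ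
  have hρφ := hρ φ
  have df := ((hasDerivAt_id φ).const_mul ((r : ℝ) + 1)).sub
    (((dA.div dS hS.ne').const_mul (r : ℝ)).mul ds)
  have dρ := (dA.pow (r + 1)).div (ds.mul (dS.pow r)) (mul_pos hs (pow_pos hS r)).ne'
  replace df := df.congr_of_eventuallyEq (f₁ := f) (.of_forall hf)
  replace dρ := dρ.congr_of_eventuallyEq (f₁ := ρ) (.of_forall hρ)
  simp only [Pi.mul_apply, Pi.pow_apply, Pi.div_apply] at df dρ
  rw [sin_succ]
  generalize sin (((r : ℝ) + 1) * φ) = A at *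
  generalize cos (((r : ℝ) + 1) * φ) = B at *
  generalize sin ((r : ℝ) * φ) = S at *
  generalize cos ((r : ℝ) * φ) = C at *
  generalize sin φ = s at *
  generalize cos φ = c at *
  have hf' : HasDerivAt f (((r : ℝ) ^ 2 * s ^ 2 + ((r : ℝ) + 1) * S ^ 2 -
      (r : ℝ) * S * (A * c + B * s)) / S ^ 2) φ := by
    refine df.congr_deriv ?_
    field_simp
    linear_combination (r : ℝ) ^ 2 * s * sin_diff
  have hρ' : HasDerivAt ρ (-(((r : ℝ) ^ 2 * s ^ 2 - 2 * (r : ℝ) * s * S * B + S ^ 2) * A ^ r /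
      (s ^ 2 * S ^ (r + 1)))) φ := by
    refine dρ.congr_deriv ?_
    obtain ⟨k, rfl⟩ := Nat.exists_eq_add_of_le' hr
    simp only [Nat.add_sub_cancel]
    push_cast at sin_diff ⊢
    field_simp
    linear_combination (A ^ (k + 1) * S ^ (2 * k + 2)) *
      (-((k : ℝ) + 1) ^ 2 * s * sin_diff - S * sin_pred)
  refine ⟨hf', hρ', ?_⟩
  have hD : 0 < (r : ℝ) ^ 2 * s ^ 2 - 2 * (r : ℝ) * s * S * B + S ^ 2 := by
    nlinarith [sq_nonneg ((r : ℝ) * s - S * B), mul_pos (pow_pos hS 2) (pow_pos hA 2)]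
  have hnum : (r : ℝ) ^ 2 * s ^ 2 + ((r : ℝ) + 1) * S ^ 2 - (r : ℝ) * S * (A * c + B * s) =
      (r : ℝ) ^ 2 * s ^ 2 - 2 * (r : ℝ) * s * S * B + S ^ 2 := by
    linear_combination (-(r : ℝ) * S) * sin_pred
  rw [hf'.deriv, hρ'.deriv, hρφ, hnum]
  generalize (r : ℝ) ^ 2 * s ^ 2 - 2 * (r : ℝ) * s * S * B + S ^ 2 = D at *
  have hπ := pi_pos
  field_simp
  ring
end
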